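/- arXiv:1510.08230 — 2 statements merged into one kernel-verified Lean document; each statement's English description precedes it below -/
import Mathlib

section
/- Characterization of the entropic minimizer and the entropic interpolation: under the hypotheses (Exi), (Reg1) and (Reg2), the entropic cost A(μ0,μ1) is finite, the minimization inf{ H(π|R_{01}) : π coupling of μ0 and μ1 } admits a unique minimizer π̂, and there exist measurable functions f0, g1 : ℝⁿ → [0,∞) such that dπ̂/dR_{01}(x,y) = f0(x) g1(y) for R_{01}-a.e. (x,y), where (f0, g1) solves the Schrödinger system dμ0/dm = f0 · T_1 g1 and dμ1/dm = g1 · T_1 f0 (m-a.e.). Consequently, for each t ∈ [0,1], μ_t := (T_t f0)(T_{1−t} g1)·m is a probability measure (the entropic interpolation), with μ_0 = μ0 and μ_1 = μ1. -/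
open MeasureTheory Real Filter Set
open scoped ENNReal RealInnerProductSpace Topology

noncomputable section

open Classical in
/-- Relative entropy `H(q|r)` of a probability measure `q` with respect to a σ-finite
measure `r`, with value `⊤` when it is not (finitely) defined. -/
def relEnt {α : Type*} [MeasurableSpace α] (q r : Measure α) : EReal :=
  if q ≪ r ∧ Integrable (fun x => Real.log ((q.rnDeriv r x).toReal)) q then
    (((∫ x, Real.log ((q.rnDeriv r x).toReal) ∂q) : ℝ) : EReal)
  else ⊤

/-- Entropic cost associated with a reference measure `r` on the product space:
infimum of `H(π|r)` over couplings `π` of `μ` and `ν`. -/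
def entCost {α : Type*} [MeasurableSpace α] (r : Measure (α × α)) (μ ν : Measure α) : EReal :=
  sInf { e : EReal | ∃ pl : Measure (α × α), IsProbabilityMeasure pl ∧
    pl.map Prod.fst = μ ∧ pl.map Prod.snd = ν ∧ e = relEnt pl r }

/-- Laplacian of `f : ℝⁿ → ℝ` as the sum of second directional derivatives along the
standard basis. -/
def lap (n : ℕ) (f : EuclideanSpace ℝ (Fin n) → ℝ) (x : EuclideanSpace ℝ (Fin n)) : ℝ :=
  ∑ i : Fin n, iteratedDeriv 2 (fun s : ℝ => f (x + s • EuclideanSpace.single i (1 : ℝ))) 0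

/-- Existence hypothesis (Exi). -/
def Exi (n : ℕ) (V : EuclideanSpace ℝ (Fin n) → ℝ) : Prop :=
  (Tendsto V (cocompact (EuclideanSpace ℝ (Fin n))) atTop ∧
      BddBelow (Set.range fun x => ‖gradient V x‖ ^ 2 - lap n V x / 2)) ∨
    ∃ c : ℝ, 0 < c ∧ ∀ x : EuclideanSpace ℝ (Fin n), -⟪x, gradient V x⟫ ≤ c * (1 + ‖x‖ ^ 2)

/-- The measure `m = e^{-V}·Leb`. -/
def mV (n : ℕ) (V : EuclideanSpace ℝ (Fin n) → ℝ) : Measure (EuclideanSpace ℝ (Fin n)) :=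
  volume.withDensity fun x => ENNReal.ofReal (Real.exp (-V x))

/-- The semigroup associated with a kernel family `p` and reference measure `m`:
`T_t f (x) = ∫ f(y) p_t(x,y) m(dy)` for `t ≠ 0`, `T_0 f = f`. -/
def Tsg (n : ℕ) (m : Measure (EuclideanSpace ℝ (Fin n)))
    (p : ℝ → EuclideanSpace ℝ (Fin n) → EuclideanSpace ℝ (Fin n) → ℝ) (t : ℝ)
    (f : EuclideanSpace ℝ (Fin n) → ℝ) (x : EuclideanSpace ℝ (Fin n)) : ℝ :=
  if t = 0 then f x else ∫ y, f y * p t x y ∂m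

/-- Hypothesis (Reg1) together with the defining properties of the Kolmogorov
Markov semigroup with generator `½(Δ - ∇V·∇)`: `p` is a symmetric probability density
kernel with respect to `m`, satisfying the Chapman-Kolmogorov equation, and the
associated semigroup solves the backward Kolmogorov equation. -/
structure IsKolmogorov (n : ℕ) (V : EuclideanSpace ℝ (Fin n) → ℝ)
    (m : Measure (EuclideanSpace ℝ (Fin n)))
    (p : ℝ → EuclideanSpace ℝ (Fin n) → EuclideanSpace ℝ (Fin n) → ℝ) : Prop where
  meas : ∀ t, Measurable (Function.uncurry (p t))
  nonneg : ∀ t x y, 0 ≤ p t x y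
  symm : ∀ t x y, p t x y = p t y x
  mass : ∀ t, 0 < t → ∀ x, ∫ y, p t x y ∂m = 1
  chapman : ∀ s t, 0 < s → 0 < t → ∀ x y, ∫ z, p s x z * p t z y ∂m = p (s + t) x y
  generator : ∀ f : EuclideanSpace ℝ (Fin n) → ℝ, ContDiff ℝ (⊤ : ℕ∞) f →
    HasCompactSupport f → ∀ t, 0 < t → ∀ x,
      HasDerivAt (fun s => Tsg n m p s f x)
        (2⁻¹ * (lap n (Tsg n m p t f) x - ⟪gradient V x, gradient (Tsg n m p t f) x⟫)) t

/-- Regularity hypothesis (Reg2) for the kernel `p` and the marginals `μ0, μ1`. -/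
def Reg2 (n : ℕ) (m : Measure (EuclideanSpace ℝ (Fin n)))
    (p : EuclideanSpace ℝ (Fin n) → EuclideanSpace ℝ (Fin n) → ℝ)
    (μ0 μ1 : Measure (EuclideanSpace ℝ (Fin n))) : Prop :=
  (∃ A B : EuclideanSpace ℝ (Fin n) → ℝ, Measurable A ∧ Measurable B ∧
      (∀ x, 0 ≤ A x) ∧ (∀ x, 0 ≤ B x) ∧
      (∀ x y, Real.exp (-A x - A y) ≤ p x y) ∧
      Integrable (fun z : EuclideanSpace ℝ (Fin n) × EuclideanSpace ℝ (Fin n) =>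
        Real.exp (-B z.1 - B z.2) * p z.1 z.2) (m.prod m) ∧
      Integrable (fun x => A x + B x) μ0 ∧ Integrable (fun x => A x + B x) μ1) ∧
    relEnt μ0 m ≠ ⊤ ∧ relEnt μ1 m ≠ ⊤

/-- The joint law `R₀₁(dx dy) = m(dx) p(x,y) m(dy)` of the initial and final positions. -/
def R01 (n : ℕ) (m : Measure (EuclideanSpace ℝ (Fin n)))
    (p : EuclideanSpace ℝ (Fin n) → EuclideanSpace ℝ (Fin n) → ℝ) :
    Measure (EuclideanSpace ℝ (Fin n) × EuclideanSpace ℝ (Fin n)) :=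
  (m.prod m).withDensity fun z => ENNReal.ofReal (p z.1 z.2)

/-- `z log (z / e^k) - z + e^k`. -/
def entInt (k z : ℝ) : ℝ := z * log z - z * k - z + exp k

lemma entInt_nonneg (k : ℝ) {z : ℝ} (hz : 0 ≤ z) : 0 ≤ entInt k z := by
  unfold entInt
  rcases hz.eq_or_lt with rfl | hz
  · simp [(exp_pos k).le]
  have h := log_le_sub_one_of_pos (div_pos (exp_pos k) hz)
  rw [log_div (exp_pos k).ne' hz.ne', log_exp] at h
  have h2 := mul_le_mul_of_nonneg_left h hz.le
  have h3 : z * (exp k / z - 1) = exp k - z := by field_simp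
  rw [h3] at h2
  nlinarith

lemma continuous_entInt : Continuous fun q : ℝ × ℝ => entInt q.1 q.2 := by
  unfold entInt
  have h : Continuous fun q : ℝ × ℝ => q.2 * log q.2 :=
    continuous_mul_log.comp continuous_snd
  fun_prop

lemma sub_sq_le_four_mul_entInt_gap (k : ℝ) {x y : ℝ} (hx : 0 ≤ x) (hy : 0 ≤ y) :
    (x - y) ^ 2 ≤ 4 * (x + y) * (entInt k x + entInt k y - 2 * entInt k ((x + y) / 2)) := by
  have key : ∀ u m : ℝ, 0 ≤ u → 0 < m → u - m + (√u - √m) ^ 2 ≤ u * log u - u * log m := by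
    intro u m hu hm
    rcases hu.eq_or_lt with rfl | hu
    · simp [sq_sqrt hm.le]
    have hsu := sqrt_pos.2 hu
    have hsm := sqrt_pos.2 hm
    have h := log_le_sub_one_of_pos (div_pos hsm hsu)
    rw [log_div hsm.ne' hsu.ne', log_sqrt hm.le, log_sqrt hu.le] at h
    have h2 := mul_le_mul_of_nonneg_left h hu.le
    have h3 : u * (√m / √u - 1) = √u * √m - u := by
      have e := mul_self_sqrt hu.le
      field_simp
      linear_combination (-√m) * e
    have e1 := sq_sqrt hu.le
    have e2 := sq_sqrt hm.le
    nlinarith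
  rcases (add_nonneg hx hy).eq_or_lt with h0 | h0
  · have hx0 : x = 0 := by linarith
    have hy0 : y = 0 := by linarith
    simp [hx0, hy0]
  set m := (x + y) / 2 with hm
  have hmpos : 0 < m := by positivity
  have hgap : (√x - √m) ^ 2 + (√y - √m) ^ 2 ≤
      entInt k x + entInt k y - 2 * entInt k m := by
    have h1 := key x m hx hmpos
    have h2 := key y m hy hmpos
    have h3 : x * log m + y * log m = 2 * (m * log m) := by rw [hm]; ring
    have h4 : x + y = 2 * m := by rw [hm]; ring
    have h5 : x * k + y * k = 2 * (m * k) := by rw [hm]; ring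
    unfold entInt
    linarith
  refine le_trans ?_ (mul_le_mul_of_nonneg_left hgap (by positivity))
  have e1 := sq_sqrt hx
  have e2 := sq_sqrt hy
  have h4 : x + y = 2 * m := by rw [hm]; ring
  have h5 : √m ^ 2 = m := sq_sqrt hmpos.le
  have ha := sqrt_nonneg x
  have hb := sqrt_nonneg y
  have hd : (x - y) ^ 2 = (√x - √y) ^ 2 * (√x + √y) ^ 2 := by
    rw [← mul_pow]; congr 1; nlinarith
  have hs : (√x + √y) ^ 2 ≤ 2 * (x + y) := by nlinarith [sq_nonneg (√x - √y)]
  have hr : (√x - √y) ^ 2 ≤ 2 * ((√x - √m) ^ 2 + (√y - √m) ^ 2) := by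
    nlinarith [sq_nonneg (√x + √y - 2 * √m)]
  rw [hd]
  calc _ ≤ (2 * ((√x - √m) ^ 2 + (√y - √m) ^ 2)) * (2 * (x + y)) := by gcongr
    _ = _ := by ring

lemma abs_sub_le_entInt_gap (k : ℝ) {x y t : ℝ} (hx : 0 ≤ x) (hy : 0 ≤ y) (ht : 0 < t) :
    |x - y| ≤ t * (x + y) +
      (entInt k x + entInt k y - 2 * entInt k ((x + y) / 2)) / t := by
  have h := sub_sq_le_four_mul_entInt_gap k hx hy
  set g := entInt k x + entInt k y - 2 * entInt k ((x + y) / 2)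
  have hxy := add_nonneg hx hy
  have hg : 0 ≤ t * (x + y) + g / t := by
    rcases hxy.eq_or_lt with h0 | h0
    · have hx0 : x = 0 := by linarith
      have hy0 : y = 0 := by linarith
      have : g = 0 := by simp only [g, hx0, hy0]; norm_num; ring
      simp [this, ← h0]
    · have : 0 ≤ g := by
        by_contra! hneg
        nlinarith [sq_nonneg (x - y), mul_pos h0 (neg_pos.2 hneg)]
      positivity
  refine abs_le_of_sq_le_sq ?_ hg
  have h1 : (t * (x + y)) * (g / t) = (x + y) * g := by field_simp
  nlinarith [sq_nonneg (t * (x + y) - g / t)]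

lemma entInt_midpoint_le (k : ℝ) {x y : ℝ} (hx : 0 ≤ x) (hy : 0 ≤ y) :
    entInt k ((x + y) / 2) ≤ entInt k x + entInt k y := by
  have h := abs_sub_le_entInt_gap k hx hy one_pos
  have h0 := entInt_nonneg k hx
  have h1 := entInt_nonneg k hy
  have h2 := entInt_nonneg k (z := (x + y) / 2) (by positivity)
  by_contra! hlt
  have h3 := sub_sq_le_four_mul_entInt_gap k hx hy
  rcases (add_nonneg hx hy).eq_or_lt with h0 | h0
  · have hx0 : x = 0 := by linarith
    have hy0 : y = 0 := by linarith
    subst hx0 hy0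
    norm_num at hlt
    linarith
  · nlinarith [sq_nonneg (x - y), mul_pos h0 (sub_pos.2 hlt)]

lemma entInt_segment_le (k : ℝ) {z e : ℝ} (hz : 0 ≤ z) (he : 0 < e) (he1 : e ≤ 1) :
    entInt k ((1 - e) * z + e) ≤
      (1 - e) * entInt k z + e * entInt k 1 + if z = 0 then e * log e else 0 := by
  split_ifs with h
  · subst h
    unfold entInt
    simp
    nlinarith
  · have h := convexOn_mul_log.2 (mem_Ici.2 hz) (mem_Ici.2 zero_le_one) (sub_nonneg.2 he1) he.le
      (sub_add_cancel 1 e)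
    simp only [smul_eq_mul, mul_one, log_one, mul_zero, add_zero] at h
    unfold entInt
    rw [log_one]
    nlinarith

lemma entInt_add_le (k : ℝ) {z d : ℝ} (hz : 0 < z) (hd : -z < d) :
    entInt k (z + d) ≤ entInt k z + d * (log z - k) + d ^ 2 / z := by
  have hzd : 0 < z + d := by linarith
  have h := log_le_sub_one_of_pos (div_pos hzd hz)
  rw [log_div hzd.ne' hz.ne'] at h
  have h2 := mul_le_mul_of_nonneg_left h hzd.le
  have h3 : (z + d) * ((z + d) / z - 1) = d + d ^ 2 / z := by field_simp; ring
  rw [h3] at h2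
  unfold entInt
  nlinarith

section Existence

variable {α : Type*} [MeasurableSpace α] {P : Measure α} {κ : α → ℝ}

lemma aestronglyMeasurable_entInt (hκ : Measurable κ) {Z : α → ℝ}
    (hZ : AEStronglyMeasurable Z P) : AEStronglyMeasurable (fun q => entInt (κ q) (Z q)) P :=
  continuous_entInt.comp_aestronglyMeasurable (hκ.aestronglyMeasurable.prodMk hZ)

lemma integrable_entInt_of_le (hκ : Measurable κ) {Z g : α → ℝ}
    (hZ : AEStronglyMeasurable Z P) (hZ0 : ∀ᵐ q ∂P, 0 ≤ Z q) (hg : Integrable g P)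
    (hle : ∀ᵐ q ∂P, entInt (κ q) (Z q) ≤ g q) :
    Integrable (fun q => entInt (κ q) (Z q)) P := by
  refine hg.mono' (aestronglyMeasurable_entInt hκ hZ) ?_
  filter_upwards [hZ0, hle] with q h0 h1
  rwa [norm_of_nonneg (entInt_nonneg _ h0)]

lemma integrable_entInt_midpoint (hκ : Measurable κ) {Z W : α → ℝ}
    (hZ : AEStronglyMeasurable Z P) (hW : AEStronglyMeasurable W P)
    (hZ0 : ∀ᵐ q ∂P, 0 ≤ Z q) (hW0 : ∀ᵐ q ∂P, 0 ≤ W q)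
    (hEZ : Integrable (fun q => entInt (κ q) (Z q)) P)
    (hEW : Integrable (fun q => entInt (κ q) (W q)) P) :
    Integrable (fun q => entInt (κ q) ((Z q + W q) / 2)) P := by
  refine integrable_entInt_of_le hκ (by fun_prop) ?_ (hEZ.add hEW) ?_
  · filter_upwards [hZ0, hW0] with q h0 h1
    positivity
  · filter_upwards [hZ0, hW0] with q h0 h1
    exact entInt_midpoint_le _ h0 h1

lemma integral_abs_sub_le_entInt_gap (hκ : Measurable κ) {Z W : α → ℝ}
    (hZ : Integrable Z P) (hW : Integrable W P)
    (hZ0 : ∀ᵐ q ∂P, 0 ≤ Z q) (hW0 : ∀ᵐ q ∂P, 0 ≤ W q)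
    (hZ1 : ∫ q, Z q ∂P = 1) (hW1 : ∫ q, W q ∂P = 1)
    (hEZ : Integrable (fun q => entInt (κ q) (Z q)) P)
    (hEW : Integrable (fun q => entInt (κ q) (W q)) P) {t : ℝ} (ht : 0 < t) :
    ∫ q, |Z q - W q| ∂P ≤ 2 * t + (∫ q, entInt (κ q) (Z q) ∂P + ∫ q, entInt (κ q) (W q) ∂P -
      2 * ∫ q, entInt (κ q) ((Z q + W q) / 2) ∂P) / t := by
  have hEM := integrable_entInt_midpoint hκ hZ.1 hW.1 hZ0 hW0 hEZ hEW
  have hadd : Integrable (fun q => entInt (κ q) (Z q) + entInt (κ q) (W q)) P := hEZ.add hEW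
  have hs : Integrable (fun q => t * (Z q + W q)) P := (hZ.add hW).const_mul t
  have hg : Integrable (fun q => (entInt (κ q) (Z q) + entInt (κ q) (W q) -
      2 * entInt (κ q) ((Z q + W q) / 2)) / t) P :=
    (hadd.sub (hEM.const_mul 2)).div_const t
  calc ∫ q, |Z q - W q| ∂P ≤ ∫ q, (t * (Z q + W q) + (entInt (κ q) (Z q) +
        entInt (κ q) (W q) - 2 * entInt (κ q) ((Z q + W q) / 2)) / t) ∂P := by
        refine integral_mono_ae (hZ.sub hW).abs (hs.add hg) ?_
        filter_upwards [hZ0, hW0] with q h0 h1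
        exact abs_sub_le_entInt_gap _ h0 h1 ht
    _ = _ := by
        rw [integral_add hs hg, integral_const_mul, integral_add hZ hW, integral_div,
          integral_sub hadd (hEM.const_mul 2), integral_const_mul, integral_add hEZ hEW,
          hZ1, hW1]
        ring

lemma entInt_lowerSemicontinuous (hκ : Measurable κ) {F : ℕ → α →₁[P] ℝ} {f : α →₁[P] ℝ} {I : ℝ}
    (hf : Tendsto F atTop (𝓝 f)) (hF0 : ∀ i, ∀ᵐ q ∂P, 0 ≤ F i q) (hf0 : ∀ᵐ q ∂P, 0 ≤ f q)
    (hFi : ∀ i, Integrable (fun q => entInt (κ q) (F i q)) P)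
    (hI : Tendsto (fun i => ∫ q, entInt (κ q) (F i q) ∂P) atTop (𝓝 I)) :
    Integrable (fun q => entInt (κ q) (f q)) P ∧ ∫ q, entInt (κ q) (f q) ∂P ≤ I := by
  have hnnF : ∀ i, 0 ≤ᵐ[P] fun q => entInt (κ q) (F i q) := fun i => by
    filter_upwards [hF0 i] with q hq
    exact entInt_nonneg _ hq
  have hnn : 0 ≤ᵐ[P] fun q => entInt (κ q) (f q) := by
    filter_upwards [hf0] with q hq
    exact entInt_nonneg _ hq
  obtain ⟨ns, hns, hae⟩ := (tendstoInMeasure_of_tendsto_Lp hf).exists_seq_tendsto_ae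
  have hlint : ∫⁻ q, ENNReal.ofReal (entInt (κ q) (f q)) ∂P ≤ ENNReal.ofReal I := by
    calc ∫⁻ q, ENNReal.ofReal (entInt (κ q) (f q)) ∂P
        = ∫⁻ q, liminf (fun i => ENNReal.ofReal (entInt (κ q) (F (ns i) q))) atTop ∂P := by
          refine lintegral_congr_ae ?_
          filter_upwards [hae] with q hq
          refine (Tendsto.liminf_eq ?_).symm
          refine (ENNReal.continuous_ofReal.tendsto _).comp ?_
          exact (continuous_entInt.tendsto (κ q, f q)).comp (tendsto_const_nhds.prodMk_nhds hq)
      _ ≤ liminf (fun i => ∫⁻ q, ENNReal.ofReal (entInt (κ q) (F (ns i) q)) ∂P) atTop :=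
          lintegral_liminf_le' fun i => (aestronglyMeasurable_entInt hκ
            (L1.integrable_coeFn _).1).aemeasurable.ennreal_ofReal
      _ = liminf (fun i => ENNReal.ofReal (∫ q, entInt (κ q) (F (ns i) q) ∂P)) atTop := by
          congr 1
          funext i
          rw [← ofReal_integral_eq_lintegral_ofReal (hFi (ns i)) (hnnF _)]
      _ = ENNReal.ofReal I :=
          ((ENNReal.continuous_ofReal.tendsto _).comp
            (hI.comp hns.tendsto_atTop)).liminf_eq
  have hfi : Integrable (fun q => entInt (κ q) (f q)) P := by
    refine ⟨aestronglyMeasurable_entInt hκ (L1.integrable_coeFn f).1, ?_⟩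
    rw [hasFiniteIntegral_iff_ofReal hnn]
    exact hlint.trans_lt ENNReal.ofReal_lt_top
  have hI0 : 0 ≤ I := ge_of_tendsto' hI fun i => integral_nonneg_of_ae (hnnF i)
  refine ⟨hfi, ?_⟩
  rw [← ofReal_integral_eq_lintegral_ofReal hfi hnn] at hlint
  exact (ENNReal.ofReal_le_ofReal_iff hI0).1 hlint

lemma exists_entInt_minimizer (hκ : Measurable κ) {C : Set (α →₁[P] ℝ)} (hC : IsClosed C)
    (hmid : ∀ f ∈ C, ∀ g ∈ C, (2⁻¹ : ℝ) • (f + g) ∈ C)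
    (hpos : ∀ f ∈ C, ∀ᵐ q ∂P, 0 ≤ f q) (hone : ∀ f ∈ C, ∫ q, f q ∂P = 1)
    (hne : ∃ f ∈ C, Integrable (fun q => entInt (κ q) (f q)) P) :
    ∃ f ∈ C, Integrable (fun q => entInt (κ q) (f q)) P ∧
      ∀ g ∈ C, Integrable (fun q => entInt (κ q) (g q)) P →
        ∫ q, entInt (κ q) (f q) ∂P ≤ ∫ q, entInt (κ q) (g q) ∂P := by
  set E : (α →₁[P] ℝ) → ℝ := fun f => ∫ q, entInt (κ q) (f q) ∂P with hE
  set S : Set (α →₁[P] ℝ) := {f ∈ C | Integrable (fun q => entInt (κ q) (f q)) P} with hS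
  have hSne : (E '' S).Nonempty := by
    obtain ⟨f, hf, hf'⟩ := hne
    exact ⟨_, f, ⟨hf, hf'⟩, rfl⟩
  have hbdd : BddBelow (E '' S) := by
    refine ⟨0, ?_⟩
    rintro _ ⟨f, hf, rfl⟩
    refine integral_nonneg_of_ae ?_
    filter_upwards [hpos f hf.1] with q hq
    exact entInt_nonneg _ hq
  obtain ⟨u, hu_anti, hu_lim, hu_mem⟩ := exists_seq_tendsto_sInf hSne hbdd
  set I := sInf (E '' S) with hI
  choose F hFS hFE using hu_mem
  have hI_le : ∀ f ∈ S, I ≤ E f := fun f hf => csInf_le hbdd ⟨f, hf, rfl⟩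
  have hdist : ∀ f ∈ S, ∀ g ∈ S, ∀ t : ℝ, 0 < t →
      dist f g ≤ 2 * t + (E f + E g - 2 * I) / t := by
    intro f hf g hg t ht
    have h := integral_abs_sub_le_entInt_gap hκ (L1.integrable_coeFn f) (L1.integrable_coeFn g)
      (hpos f hf.1) (hpos g hg.1) (hone f hf.1) (hone g hg.1) hf.2 hg.2 ht
    have hM := integrable_entInt_midpoint hκ (L1.integrable_coeFn f).1 (L1.integrable_coeFn g).1
      (hpos f hf.1) (hpos g hg.1) hf.2 hg.2
    have hcoe : (fun q => entInt (κ q) (((2⁻¹ : ℝ) • (f + g) : α →₁[P] ℝ) q)) =ᵐ[P]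
        fun q => entInt (κ q) ((f q + g q) / 2) := by
      filter_upwards [Lp.coeFn_smul (2⁻¹ : ℝ) (f + g), Lp.coeFn_add f g] with q h1 h2
      rw [h1, Pi.smul_apply, h2, Pi.add_apply, smul_eq_mul]
      congr 1
      ring
    have hmem : (2⁻¹ : ℝ) • (f + g) ∈ S :=
      ⟨hmid f hf.1 g hg.1, hM.congr hcoe.symm⟩
    have h2 := hI_le _ hmem
    simp only [hE] at h2
    rw [integral_congr_ae hcoe] at h2
    rw [L1.dist_eq_integral_dist]
    simp only [Real.dist_eq]
    refine h.trans ?_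
    simp only [hE]
    gcongr
  have hcauchy : CauchySeq F := by
    clear_value E S I
    rw [Metric.cauchySeq_iff]
    intro ε hε
    have ht : (0 : ℝ) < ε / 8 := by positivity
    obtain ⟨N, hN⟩ := (hu_lim.eventually (gt_mem_nhds
      (show I < I + ε ^ 2 / 64 by linarith [pow_pos hε 2]))).exists_forall_of_atTop
    refine ⟨N, fun i hi j hj => ?_⟩
    have h := hdist (F i) (hFS i) (F j) (hFS j) (ε / 8) ht
    rw [hFE, hFE] at h
    have h1 := hN i hi
    have h2 := hN j hj
    have h3 : (u i + u j - 2 * I) / (ε / 8) ≤ (ε ^ 2 / 32) / (ε / 8) := by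
      gcongr
      linarith
    have h4 : (ε ^ 2 / 32) / (ε / 8) = ε / 4 := by field_simp; norm_num
    linarith
  obtain ⟨f, hf⟩ := cauchySeq_tendsto_of_complete hcauchy
  have hfC : f ∈ C := hC.mem_of_tendsto hf (Eventually.of_forall fun i => (hFS i).1)
  obtain ⟨hfi, hfE⟩ := entInt_lowerSemicontinuous hκ hf (fun i => hpos _ (hFS i).1)
    (hpos f hfC) (fun i => (hFS i).2) (hu_lim.congr fun i => (hFE i).symm)
  exact ⟨f, hfC, hfi, fun g hg hgi => hfE.trans (hI_le g ⟨hg, hgi⟩)⟩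

end Existence

section FirstVariation

variable {α : Type*} [MeasurableSpace α] {P : Measure α} {κ : α → ℝ}

lemma ae_pos_of_entInt_le_segment [IsProbabilityMeasure P] (hκ : Measurable κ)
    (hκi : Integrable κ P) (hκe : Integrable (fun q => exp (κ q)) P) {Z : α → ℝ}
    (hZ : Measurable Z) (hZ0 : ∀ q, 0 ≤ Z q)
    (hEZ : Integrable (fun q => entInt (κ q) (Z q)) P)
    (hmin : ∀ e : ℝ, 0 < e → e < 1 →
      Integrable (fun q => entInt (κ q) ((1 - e) * Z q + e)) P →
      ∫ q, entInt (κ q) (Z q) ∂P ≤ ∫ q, entInt (κ q) ((1 - e) * Z q + e) ∂P) :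
    ∀ᵐ q ∂P, 0 < Z q := by
  have hE1 : Integrable (fun q => entInt (κ q) 1) P := by
    unfold entInt
    exact (((integrable_const _).sub (hκi.const_mul 1)).sub (integrable_const _)).add hκe
  set N : Set α := Z ⁻¹' {0}
  have hN : MeasurableSet N := hZ (measurableSet_singleton 0)
  have key : ∀ e : ℝ, 0 < e → e < 1 →
      - log e * P.real N ≤ ∫ q, entInt (κ q) 1 ∂P - ∫ q, entInt (κ q) (Z q) ∂P := by
    intro e he he1
    have hi1 : Integrable (fun q => (1 - e) * entInt (κ q) (Z q) + e * entInt (κ q) 1) P :=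
      (hEZ.const_mul _).add (hE1.const_mul _)
    have hi2 : Integrable (N.indicator fun _ => e * log e) P :=
      (integrable_const _).indicator hN
    have hi3 : Integrable (fun q => (1 - e) * entInt (κ q) (Z q) + e * entInt (κ q) 1 +
        N.indicator (fun _ => e * log e) q) P := hi1.add hi2
    have hle : ∀ q, entInt (κ q) ((1 - e) * Z q + e) ≤
        (1 - e) * entInt (κ q) (Z q) + e * entInt (κ q) 1 +
          N.indicator (fun _ => e * log e) q := by
      intro q
      have h := entInt_segment_le (κ q) (hZ0 q) he he1.le
      simpa only [N, indicator, mem_preimage, mem_singleton_iff] using h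
    have hi := integrable_entInt_of_le hκ (Z := fun q => (1 - e) * Z q + e) (by fun_prop)
      (Eventually.of_forall fun q => by
        have := mul_nonneg (sub_nonneg.2 he1.le) (hZ0 q)
        linarith) hi3 (Eventually.of_forall hle)
    have h := (hmin e he he1 hi).trans (integral_mono hi hi3 hle)
    rw [integral_add hi1 hi2, integral_add (hEZ.const_mul _) (hE1.const_mul _),
      integral_const_mul, integral_const_mul, integral_indicator_const _ hN, smul_eq_mul] at h
    refine le_of_mul_le_mul_left ?_ he
    linarith
  have hN0 : P.real N = 0 := by
    by_contra hne
    have hp : 0 < P.real N := lt_of_le_of_ne measureReal_nonneg (Ne.symm hne)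
    set D := ∫ q, entInt (κ q) 1 ∂P - ∫ q, entInt (κ q) (Z q) ∂P
    have h := key (exp (-((|D| + 1) / P.real N))) (exp_pos _)
      (Real.exp_lt_one_iff.2 (by
        have : 0 < (|D| + 1) / P.real N := by positivity
        linarith))
    rw [log_exp, neg_neg, div_mul_cancel₀ _ hne] at h
    linarith [le_abs_self D]
  have hN1 : P N = 0 := (measureReal_eq_zero_iff).1 hN0
  filter_upwards [measure_eq_zero_iff_ae_notMem.1 hN1] with q hq
  exact lt_of_le_of_ne (hZ0 q) fun h => hq h.symm

lemma integrable_mul_log_sub (hκe : Integrable (fun q => exp (κ q)) P) {Z : α → ℝ}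
    (hZi : Integrable Z P) (hEZ : Integrable (fun q => entInt (κ q) (Z q)) P) :
    Integrable (fun q => Z q * (log (Z q) - κ q)) P := by
  refine ((hEZ.add hZi).sub hκe).congr (Eventually.of_forall fun q => ?_)
  simp only [entInt, Pi.sub_apply, Pi.add_apply]
  ring

lemma integral_mul_log_sub_nonpos (hκ : Measurable κ)
    (hκe : Integrable (fun q => exp (κ q)) P) {Z s : α → ℝ}
    (hZ : Measurable Z) (hZ0 : ∀ᵐ q ∂P, 0 < Z q) (hZi : Integrable Z P)
    (hZ1 : ∫ q, Z q ∂P = 1)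
    (hEZ : Integrable (fun q => entInt (κ q) (Z q)) P)
    (hs : Measurable s) (hsZ : ∀ᵐ q ∂P, |s q| ≤ Z q)
    (hmin : ∀ t : ℝ, 0 < t → t < 1 →
      Integrable (fun q => entInt (κ q) (Z q - t * s q)) P →
      ∫ q, entInt (κ q) (Z q) ∂P ≤ ∫ q, entInt (κ q) (Z q - t * s q) ∂P) :
    ∫ q, s q * (log (Z q) - κ q) ∂P ≤ 0 := by
  have hL := integrable_mul_log_sub hκe hZi hEZ
  have hsL : Integrable (fun q => s q * (log (Z q) - κ q)) P := by
    refine hL.mono (by fun_prop) ?_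
    filter_upwards [hsZ, hZ0] with q h h0
    rw [norm_mul, norm_mul]
    gcongr
    rw [norm_eq_abs, norm_of_nonneg h0.le]
    exact h
  have key : ∀ t : ℝ, 0 < t → t < 1 → ∫ q, s q * (log (Z q) - κ q) ∂P ≤ t := by
    intro t ht ht1
    have hi1 : Integrable (fun q => entInt (κ q) (Z q) + -t * (s q * (log (Z q) - κ q))) P :=
      hEZ.add (hsL.const_mul _)
    have hi2 : Integrable (fun q => t ^ 2 * Z q) P := hZi.const_mul _
    have hi3 : Integrable (fun q => entInt (κ q) (Z q) + -t * (s q * (log (Z q) - κ q)) +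
        t ^ 2 * Z q) P := hi1.add hi2
    have hlt : ∀ᵐ q ∂P, |t * s q| < Z q := by
      filter_upwards [hsZ, hZ0] with q h h0
      rw [abs_mul, abs_of_pos ht]
      nlinarith [abs_nonneg (s q)]
    have hle : ∀ᵐ q ∂P, entInt (κ q) (Z q - t * s q) ≤
        entInt (κ q) (Z q) + -t * (s q * (log (Z q) - κ q)) + t ^ 2 * Z q := by
      filter_upwards [hsZ, hZ0, hlt] with q h h0 h1
      have h2 := entInt_add_le (κ q) h0 (d := -(t * s q)) (by linarith [le_abs_self (t * s q)])
      have h3 : (-(t * s q)) ^ 2 / Z q ≤ t ^ 2 * Z q := by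
        rw [div_le_iff₀ h0]
        have := sq_le_sq' (abs_le.1 h).1 (abs_le.1 h).2
        nlinarith [sq_nonneg t]
      rw [← sub_eq_add_neg] at h2
      linarith
    have hi := integrable_entInt_of_le hκ (Z := fun q => Z q - t * s q) (by fun_prop)
      (by
        filter_upwards [hlt] with q h
        linarith [le_abs_self (t * s q)]) hi3 hle
    have h := (hmin t ht ht1 hi).trans (integral_mono_ae hi hi3 hle)
    rw [integral_add hi1 hi2, integral_add hEZ (hsL.const_mul _),
      integral_const_mul, integral_const_mul, hZ1] at h
    refine le_of_mul_le_mul_left ?_ ht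
    linarith
  by_contra! hpos
  set J := ∫ q, s q * (log (Z q) - κ q) ∂P
  have h := key (min (J / 2) (1 / 2)) (by positivity)
    (lt_of_le_of_lt (min_le_right _ _) (by norm_num))
  linarith [min_le_left (J / 2) (1 / 2 : ℝ)]

end FirstVariation

section Coupling

variable {X Y : Type*} [MeasurableSpace X] [MeasurableSpace Y]

/-- `Z` is the density with respect to `μ ⊗ ν` of a coupling of `μ` and `ν`. -/
structure IsCouplingDensity (μ : Measure X) (ν : Measure Y) (Z : X × Y → ℝ) : Prop where
  measurable : Measurable Z
  nonneg : ∀ q, 0 ≤ Z q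
  integrable : Integrable Z (μ.prod ν)
  fst : ∀ A, MeasurableSet A → ∫ q in Prod.fst ⁻¹' A, Z q ∂(μ.prod ν) = μ.real A
  snd : ∀ B, MeasurableSet B → ∫ q in Prod.snd ⁻¹' B, Z q ∂(μ.prod ν) = ν.real B

variable {μ : Measure X} {ν : Measure Y} {κ Z W : X × Y → ℝ}

lemma IsCouplingDensity.integral_eq_one [IsProbabilityMeasure μ]
    (hZ : IsCouplingDensity μ ν Z) : ∫ q, Z q ∂(μ.prod ν) = 1 := by
  simpa using hZ.fst univ MeasurableSet.univ

lemma isCouplingDensity_one [IsProbabilityMeasure μ] [IsProbabilityMeasure ν] :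
    IsCouplingDensity μ ν (fun _ => 1) where
  measurable := measurable_const
  nonneg _ := zero_le_one
  integrable := integrable_const _
  fst A hA := by
    rw [← prod_univ]
    simp [measureReal_prod_prod]
  snd B hB := by
    rw [← univ_prod]
    simp [measureReal_prod_prod]

lemma IsCouplingDensity.combine (hZ : IsCouplingDensity μ ν Z) (hW : IsCouplingDensity μ ν W)
    {a b : ℝ} (ha : 0 ≤ a) (hb : 0 ≤ b) (hab : a + b = 1) :
    IsCouplingDensity μ ν (fun q => a * Z q + b * W q) where
  measurable := (hZ.measurable.const_mul a).add (hW.measurable.const_mul b)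
  nonneg q := add_nonneg (mul_nonneg ha (hZ.nonneg q)) (mul_nonneg hb (hW.nonneg q))
  integrable := (hZ.integrable.const_mul a).add (hW.integrable.const_mul b)
  fst A hA := by
    rw [integral_add (hZ.integrable.const_mul a).integrableOn
      (hW.integrable.const_mul b).integrableOn, integral_const_mul, integral_const_mul,
      hZ.fst A hA, hW.fst A hA, ← add_mul, hab, one_mul]
  snd B hB := by
    rw [integral_add (hZ.integrable.const_mul a).integrableOn
      (hW.integrable.const_mul b).integrableOn, integral_const_mul, integral_const_mul,
      hZ.snd B hB, hW.snd B hB, ← add_mul, hab, one_mul]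

lemma IsCouplingDensity.sub_of_abs_le (hZ : IsCouplingDensity μ ν Z) {s : X × Y → ℝ}
    (hs : Measurable s) (hsZ : ∀ q, |s q| ≤ Z q)
    (hs1 : ∀ A, MeasurableSet A → ∫ q in Prod.fst ⁻¹' A, s q ∂(μ.prod ν) = 0)
    (hs2 : ∀ B, MeasurableSet B → ∫ q in Prod.snd ⁻¹' B, s q ∂(μ.prod ν) = 0)
    {t : ℝ} (ht : 0 ≤ t) (ht1 : t ≤ 1) :
    IsCouplingDensity μ ν (fun q => Z q - t * s q) := by
  have hsi : Integrable s (μ.prod ν) :=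
    hZ.integrable.mono' hs.aestronglyMeasurable (Eventually.of_forall hsZ)
  refine ⟨hZ.measurable.sub (hs.const_mul t), fun q => ?_, hZ.integrable.sub (hsi.const_mul t),
    fun A hA => ?_, fun B hB => ?_⟩
  · have h1 := (le_abs_self (s q)).trans (hsZ q)
    have h2 := hZ.nonneg q
    nlinarith
  · rw [integral_sub hZ.integrable.integrableOn (hsi.const_mul t).integrableOn,
      integral_const_mul, hZ.fst A hA, hs1 A hA, mul_zero, sub_zero]
  · rw [integral_sub hZ.integrable.integrableOn (hsi.const_mul t).integrableOn,
      integral_const_mul, hZ.snd B hB, hs2 B hB, mul_zero, sub_zero]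

lemma exists_isCouplingDensity_minimizer [IsProbabilityMeasure μ] [IsProbabilityMeasure ν]
    (hκ : Measurable κ) (hκi : Integrable κ (μ.prod ν))
    (hκe : Integrable (fun q => exp (κ q)) (μ.prod ν)) :
    ∃ Z, IsCouplingDensity μ ν Z ∧ Integrable (fun q => entInt (κ q) (Z q)) (μ.prod ν) ∧
      ∀ W, IsCouplingDensity μ ν W → Integrable (fun q => entInt (κ q) (W q)) (μ.prod ν) →
        ∫ q, entInt (κ q) (Z q) ∂(μ.prod ν) ≤ ∫ q, entInt (κ q) (W q) ∂(μ.prod ν) := by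
  set P := μ.prod ν
  let C : Set (X × Y →₁[P] ℝ) := {f | 0 ≤ f ∧
    (∀ A, MeasurableSet A → ∫ q in Prod.fst ⁻¹' A, f q ∂P = μ.real A) ∧
    ∀ B, MeasurableSet B → ∫ q in Prod.snd ⁻¹' B, f q ∂P = ν.real B}
  have hC : IsClosed C := by
    have hT : ∀ (T : Set (X × Y)) (r : ℝ),
        IsClosed {f : X × Y →₁[P] ℝ | ∫ q in T, f q ∂P = r} := fun T r =>
      isClosed_eq (continuous_setIntegral T) continuous_const
    have h0 : IsClosed {f : X × Y →₁[P] ℝ | 0 ≤ f} := isClosed_Ici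
    have h1 : IsClosed {f : X × Y →₁[P] ℝ |
        ∀ A, MeasurableSet A → ∫ q in Prod.fst ⁻¹' A, f q ∂P = μ.real A} := by
      simp only [ofPred_forall]
      exact isClosed_iInter fun A => isClosed_iInter fun _ => hT _ _
    have h2 : IsClosed {f : X × Y →₁[P] ℝ |
        ∀ B, MeasurableSet B → ∫ q in Prod.snd ⁻¹' B, f q ∂P = ν.real B} := by
      simp only [ofPred_forall]
      exact isClosed_iInter fun B => isClosed_iInter fun _ => hT _ _
    exact h0.inter (h1.inter h2)
  have hpos : ∀ f ∈ C, ∀ᵐ q ∂P, 0 ≤ f q := fun f hf => (Lp.coeFn_nonneg f).2 hf.1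
  have hmem : ∀ Z (hZ : IsCouplingDensity μ ν Z), hZ.integrable.toL1 Z ∈ C := by
    intro Z hZ
    have hae := hZ.integrable.coeFn_toL1
    refine ⟨(Lp.coeFn_nonneg _).1 ?_, fun A hA => ?_, fun B hB => ?_⟩
    · filter_upwards [hae] with q hq
      rw [hq]
      exact hZ.nonneg q
    · rw [← hZ.fst A hA]
      exact integral_congr_ae (ae_restrict_of_ae hae)
    · rw [← hZ.snd B hB]
      exact integral_congr_ae (ae_restrict_of_ae hae)
  have hrep : ∀ f ∈ C, ∃ Z, IsCouplingDensity μ ν Z ∧ f =ᵐ[P] Z := by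
    intro f hf
    have hm := (L1.integrable_coeFn f).1.aemeasurable
    have hae : f =ᵐ[P] fun q => max (hm.mk f q) 0 := by
      filter_upwards [hm.ae_eq_mk, hpos f hf] with q h1 h2
      rw [← h1, max_eq_left h2]
    refine ⟨fun q => max (hm.mk f q) 0, ⟨hm.measurable_mk.max measurable_const,
      fun q => le_max_right _ _, (L1.integrable_coeFn f).congr hae, fun A hA => ?_,
      fun B hB => ?_⟩, hae⟩
    · rw [← hf.2.1 A hA]
      exact (integral_congr_ae (ae_restrict_of_ae hae)).symm
    · rw [← hf.2.2 B hB]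
      exact (integral_congr_ae (ae_restrict_of_ae hae)).symm
  have hEcongr : ∀ {f g : X × Y → ℝ}, f =ᵐ[P] g →
      (fun q => entInt (κ q) (f q)) =ᵐ[P] fun q => entInt (κ q) (g q) := by
    intro f g h
    filter_upwards [h] with q hq
    rw [hq]
  have hmid : ∀ f ∈ C, ∀ g ∈ C, (2⁻¹ : ℝ) • (f + g) ∈ C := by
    intro f hf g hg
    obtain ⟨Z, hZ, hfZ⟩ := hrep f hf
    obtain ⟨W, hW, hgW⟩ := hrep g hg
    have hM := hZ.combine hW (a := 2⁻¹) (b := 2⁻¹) (by norm_num) (by norm_num) (by norm_num)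
    convert hmem _ hM using 1
    refine Lp.ext ?_
    filter_upwards [hM.integrable.coeFn_toL1, Lp.coeFn_smul (2⁻¹ : ℝ) (f + g),
      Lp.coeFn_add f g, hfZ, hgW] with q h1 h2 h3 h4 h5
    rw [h1, h2, Pi.smul_apply, h3, Pi.add_apply, h4, h5, smul_eq_mul, mul_add]
  have hone : ∀ f ∈ C, ∫ q, f q ∂P = 1 := by
    intro f hf
    simpa using hf.2.1 univ MeasurableSet.univ
  have hne : ∃ f ∈ C, Integrable (fun q => entInt (κ q) (f q)) P := by
    have h1 := isCouplingDensity_one (μ := μ) (ν := ν)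
    refine ⟨_, hmem _ h1, Integrable.congr ?_ (hEcongr h1.integrable.coeFn_toL1).symm⟩
    unfold entInt
    exact (((integrable_const _).sub (hκi.const_mul 1)).sub (integrable_const _)).add hκe
  obtain ⟨f, hfC, hfi, hfmin⟩ := exists_entInt_minimizer hκ hC hmid hpos hone hne
  obtain ⟨Z, hZ, hfZ⟩ := hrep f hfC
  refine ⟨Z, hZ, hfi.congr (hEcongr hfZ), fun W hW hWi => ?_⟩
  have hWae := hEcongr hW.integrable.coeFn_toL1
  have h := hfmin _ (hmem W hW) (hWi.congr hWae.symm)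
  rwa [integral_congr_ae (hEcongr hfZ), integral_congr_ae hWae] at h

lemma IsCouplingDensity.ae_eq_of_entInt_le [IsProbabilityMeasure μ] [IsProbabilityMeasure ν]
    (hκ : Measurable κ) (hZ : IsCouplingDensity μ ν Z) (hW : IsCouplingDensity μ ν W)
    (hEZ : Integrable (fun q => entInt (κ q) (Z q)) (μ.prod ν))
    (hEW : Integrable (fun q => entInt (κ q) (W q)) (μ.prod ν))
    (hmin : ∀ U, IsCouplingDensity μ ν U → Integrable (fun q => entInt (κ q) (U q)) (μ.prod ν) →
        ∫ q, entInt (κ q) (Z q) ∂(μ.prod ν) ≤ ∫ q, entInt (κ q) (U q) ∂(μ.prod ν))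
    (hle : ∫ q, entInt (κ q) (W q) ∂(μ.prod ν) ≤ ∫ q, entInt (κ q) (Z q) ∂(μ.prod ν)) :
    W =ᵐ[μ.prod ν] Z := by
  have hZ0 : ∀ᵐ q ∂(μ.prod ν), 0 ≤ Z q := Eventually.of_forall hZ.nonneg
  have hW0 : ∀ᵐ q ∂(μ.prod ν), 0 ≤ W q := Eventually.of_forall hW.nonneg
  have hM := hZ.combine hW (a := 2⁻¹) (b := 2⁻¹) (by norm_num) (by norm_num) (by norm_num)
  have hMeq : (fun q => 2⁻¹ * Z q + 2⁻¹ * W q) = fun q => (Z q + W q) / 2 := by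
    funext q
    ring
  rw [hMeq] at hM
  have hmid := hmin _ hM
    (integrable_entInt_midpoint hκ hZ.integrable.1 hW.integrable.1 hZ0 hW0 hEZ hEW)
  have hI : ∫ q, |Z q - W q| ∂(μ.prod ν) = 0 := by
    refine le_antisymm (le_of_forall_pos_le_add fun e he => ?_)
      (integral_nonneg fun q => abs_nonneg _)
    have h := integral_abs_sub_le_entInt_gap hκ hZ.integrable hW.integrable hZ0 hW0
      hZ.integral_eq_one hW.integral_eq_one hEZ hEW (half_pos he)
    have h2 : (∫ q, entInt (κ q) (Z q) ∂(μ.prod ν) + ∫ q, entInt (κ q) (W q) ∂(μ.prod ν) -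
        2 * ∫ q, entInt (κ q) ((Z q + W q) / 2) ∂(μ.prod ν)) / (e / 2) ≤ 0 :=
      div_nonpos_of_nonpos_of_nonneg (by linarith) (half_pos he).le
    linarith
  have hI0 := (integral_eq_zero_iff_of_nonneg (fun q => abs_nonneg _)
    (hZ.integrable.sub hW.integrable).abs).1 hI
  filter_upwards [hI0] with q hq
  have : Z q - W q = 0 := abs_eq_zero.1 hq
  linarith

end Coupling

section ProductForm

variable {X Y : Type*} [MeasurableSpace X] [MeasurableSpace Y]

/-- Exchange of the second coordinates of two pairs. -/
def exchangeSnd (w : (X × Y) × (X × Y)) : (X × Y) × (X × Y) :=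
  ((w.1.1, w.2.2), (w.2.1, w.1.2))

lemma measurable_exchangeSnd : Measurable (exchangeSnd : (X × Y) × (X × Y) → _) := by
  unfold exchangeSnd
  fun_prop

/-- The double difference of `L` over the rectangle spanned by two points. -/
def doubleDiff (L : X × Y → ℝ) (w : (X × Y) × (X × Y)) : ℝ :=
  L w.1 + L w.2 - L (exchangeSnd w).1 - L (exchangeSnd w).2

lemma measurePreserving_exchangeSnd (μ : Measure X) (ν : Measure Y) [SFinite μ] [SFinite ν] :
    MeasurePreserving exchangeSnd ((μ.prod ν).prod (μ.prod ν)) ((μ.prod ν).prod (μ.prod ν)) := by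
  have h1 := measurePreserving_prodAssoc μ ν (μ.prod ν)
  have h2 : MeasurePreserving Prod.swap (ν.prod (μ.prod ν)) ((μ.prod ν).prod ν) :=
    Measure.measurePreserving_swap
  have h3 := measurePreserving_prodAssoc μ ν ν
  have h4 : MeasurePreserving (Prod.map id Prod.swap) (μ.prod (ν.prod ν)) (μ.prod (ν.prod ν)) :=
    (MeasurePreserving.id μ).prod Measure.measurePreserving_swap
  have h5 : MeasurePreserving Prod.swap ((μ.prod ν).prod ν) (ν.prod (μ.prod ν)) :=
    Measure.measurePreserving_swap
  have h6 := (h5.comp (h3.symm _)).comp (h4.comp (h3.comp h2))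
  exact ((h1.symm _).comp (((MeasurePreserving.id μ).prod h6))).comp h1

variable {μ : Measure X} {ν : Measure Y} [IsProbabilityMeasure μ] [IsProbabilityMeasure ν]

lemma exists_add_of_doubleDiff_eq_zero {L : X × Y → ℝ} (hL : Measurable L)
    (h : ∀ᵐ w ∂((μ.prod ν).prod (μ.prod ν)), doubleDiff L w = 0) :
    ∃ (a : X → ℝ) (b : Y → ℝ), Measurable a ∧ Measurable b ∧
      ∀ᵐ q ∂(μ.prod ν), L q = a q.1 + b q.2 := by
  obtain ⟨⟨x₀, y₀⟩, h₀⟩ := (Measure.ae_ae_of_ae_prod h).exists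
  refine ⟨fun x => L (x, y₀), fun y => L (x₀, y) - L (x₀, y₀), by fun_prop, by fun_prop, ?_⟩
  filter_upwards [h₀] with q hq
  simp only [doubleDiff, exchangeSnd] at hq
  linarith

variable {κ Z : X × Y → ℝ}

lemma doubleDiff_eq_zero_of_minimizer (hκ : Measurable κ)
    (hκe : Integrable (fun q => exp (κ q)) (μ.prod ν))
    (hZ : IsCouplingDensity μ ν Z) (hZ0 : ∀ᵐ q ∂(μ.prod ν), 0 < Z q)
    (hEZ : Integrable (fun q => entInt (κ q) (Z q)) (μ.prod ν))
    (hmin : ∀ W, IsCouplingDensity μ ν W →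
      Integrable (fun q => entInt (κ q) (W q)) (μ.prod ν) →
        ∫ q, entInt (κ q) (Z q) ∂(μ.prod ν) ≤ ∫ q, entInt (κ q) (W q) ∂(μ.prod ν)) :
    ∀ᵐ w ∂((μ.prod ν).prod (μ.prod ν)), doubleDiff (fun q => log (Z q) - κ q) w = 0 := by
  set P := μ.prod ν
  set L : X × Y → ℝ := fun q => log (Z q) - κ q
  have hZm := hZ.measurable
  have hLm : Measurable L := by fun_prop
  have hτ : MeasurePreserving exchangeSnd (P.prod P) (P.prod P) :=
    measurePreserving_exchangeSnd μ ν
  have hσ : MeasurePreserving Prod.swap (P.prod P) (P.prod P) := Measure.measurePreserving_swap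
  have hτe : MeasurableEmbedding (exchangeSnd : (X × Y) × (X × Y) → _) :=
    MeasurableEquiv.measurableEmbedding
      ⟨⟨exchangeSnd, exchangeSnd, fun _ => rfl, fun _ => rfl⟩,
        measurable_exchangeSnd, measurable_exchangeSnd⟩
  have hσe : MeasurableEmbedding (Prod.swap : (X × Y) × (X × Y) → _) :=
    MeasurableEquiv.prodComm.measurableEmbedding
  set M : (X × Y) × (X × Y) → ℝ := fun w =>
    min (min (Z w.1) (Z w.2)) (min (Z (exchangeSnd w).1) (Z (exchangeSnd w).2)) with hM
  set D := doubleDiff L with hD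
  set η : (X × Y) × (X × Y) → ℝ := fun w => SignType.sign (D w) * M w with hη
  have hMm : Measurable M := by
    simp only [hM, exchangeSnd]
    fun_prop
  have hDm : Measurable D := by
    unfold D doubleDiff exchangeSnd
    fun_prop
  have hsignm : Measurable fun w => ((SignType.sign (D w) : SignType) : ℝ) := by
    have h : (fun w => ((SignType.sign (D w) : SignType) : ℝ)) =
        fun w => if 0 < D w then 1 else if D w < 0 then -1 else 0 := by
      funext w
      rcases lt_trichotomy (D w) 0 with h | h | h
      · simp [h, h.not_gt]
      · simp [h]
      · simp [h]
    rw [h]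
    exact Measurable.ite (measurableSet_lt measurable_const hDm) measurable_const
      (Measurable.ite (measurableSet_lt hDm measurable_const) measurable_const measurable_const)
  have hηm : Measurable η := hsignm.mul hMm
  have hM0 : ∀ w, 0 ≤ M w := fun w =>
    le_min (le_min (hZ.nonneg _) (hZ.nonneg _)) (le_min (hZ.nonneg _) (hZ.nonneg _))
  have hηM : ∀ w, |η w| ≤ M w := by
    intro w
    rw [hη, abs_mul, abs_of_nonneg (hM0 w)]
    refine mul_le_of_le_one_left (hM0 w) ?_
    rcases lt_trichotomy (D w) 0 with h | h | h <;> simp [h]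
  have hη1 : ∀ w, |η w| ≤ Z w.1 := fun w =>
    (hηM w).trans ((min_le_left _ _).trans (min_le_left _ _))
  have hMτ : ∀ w, M (exchangeSnd w) = M w := fun w => by
    simp only [hM]
    exact min_comm _ _
  have hMσ : ∀ w, M w.swap = M w := fun w => by
    simp only [hM, exchangeSnd, Prod.fst_swap, Prod.snd_swap]
    rw [min_comm (Z w.2), min_comm (Z (w.2.1, w.1.2))]
  have hDτ : ∀ w, D (exchangeSnd w) = - D w := fun w => by
    simp only [hD, doubleDiff, exchangeSnd]
    ring
  have hDσ : ∀ w, D w.swap = D w := fun w => by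
    simp only [hD, doubleDiff, exchangeSnd, Prod.fst_swap, Prod.snd_swap]
    ring
  have hητ : ∀ w, η (exchangeSnd w) = - η w := fun w => by
    simp only [hη, hMτ, hDτ, Left.sign_neg, SignType.coe_neg, neg_mul]
  have hησ : ∀ w, η w.swap = η w := fun w => by
    simp only [hη, hMσ, hDσ]
  have hZ1i : Integrable (fun w : (X × Y) × (X × Y) => Z w.1) (P.prod P) :=
    hZ.integrable.comp_fst P
  have hηi : Integrable η (P.prod P) :=
    hZ1i.mono' hηm.aestronglyMeasurable (Eventually.of_forall hη1)
  set s : X × Y → ℝ := fun q => ∫ q', η (q, q') ∂P with hs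
  have hsm : Measurable s := (hηm.stronglyMeasurable.integral_prod_right).measurable
  have hsZ : ∀ q, |s q| ≤ Z q := by
    intro q
    have h := norm_integral_le_of_norm_le_const (μ := P) (f := fun q' => η (q, q')) (C := Z q)
      (Eventually.of_forall fun q' => hη1 (q, q'))
    simpa using h
  have hs_int : ∀ T : Set (X × Y), MeasurableSet T →
      ∫ q in T, s q ∂P = ∫ w, (Prod.fst ⁻¹' T).indicator η w ∂(P.prod P) := by
    intro T hT
    rw [integral_prod _ (hηi.indicator (measurable_fst hT)), ← integral_indicator hT]
    refine integral_congr_ae (Eventually.of_forall fun q => ?_)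
    by_cases hq : q ∈ T
    · simp [hq, hs, indicator]
    · simp [hq, indicator]
  have hanti : ∀ f : (X × Y) × (X × Y) → ℝ, (∀ w, f (exchangeSnd w) = - f w) →
      ∫ w, f w ∂(P.prod P) = 0 := by
    intro f hf
    have h := hτ.integral_comp hτe f
    simp only [hf, integral_neg] at h
    linarith
  have hs1 : ∀ A, MeasurableSet A → ∫ q in Prod.fst ⁻¹' A, s q ∂P = 0 := by
    intro A hA
    rw [hs_int _ (measurable_fst hA)]
    refine hanti _ fun w => ?_
    by_cases hw : w.1.1 ∈ A
    · have hw' : (exchangeSnd w).1.1 ∈ A := hw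
      simp only [indicator, mem_preimage, hw, hw', if_true, hητ]
    · have hw' : (exchangeSnd w).1.1 ∉ A := hw
      simp only [indicator, mem_preimage, hw, hw', if_false, neg_zero]
  have hs2 : ∀ B, MeasurableSet B → ∫ q in Prod.snd ⁻¹' B, s q ∂P = 0 := by
    intro B hB
    rw [hs_int _ (measurable_snd hB), ← hσ.integral_comp hσe]
    have h := (hσ.integral_comp hσe fun w =>
      (Prod.fst ⁻¹' (Prod.snd ⁻¹' B)).indicator η (exchangeSnd w))
    rw [hτ.integral_comp hτe, ← hσ.integral_comp hσe] at h
    have h2 : ∀ w : (X × Y) × (X × Y),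
        (Prod.fst ⁻¹' (Prod.snd ⁻¹' B)).indicator η (exchangeSnd w.swap) =
          - (Prod.fst ⁻¹' (Prod.snd ⁻¹' B)).indicator η w := by
      intro w
      have h3 : η (exchangeSnd w.swap) = - η w := by rw [hητ, hησ]
      by_cases hw : w.1.2 ∈ B
      · have hw' : (exchangeSnd w.swap).1.2 ∈ B := hw
        simp only [indicator, mem_preimage, hw, hw', if_true, h3]
      · have hw' : (exchangeSnd w.swap).1.2 ∉ B := hw
        simp only [indicator, mem_preimage, hw, hw', if_false, neg_zero]
    simp only [h2, integral_neg] at h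
    rw [hσ.integral_comp hσe] at h ⊢
    linarith
  have hneg := integral_mul_log_sub_nonpos hκ hκe hZm hZ0 hZ.integrable hZ.integral_eq_one hEZ
    hsm (Eventually.of_forall hsZ) fun t ht ht1 hi =>
      hmin _ (hZ.sub_of_abs_le hsm hsZ hs1 hs2 ht.le ht1.le) hi
  have hZL := integrable_mul_log_sub hκe hZ.integrable hEZ
  have hηL : Integrable (fun w => η w * L w.1) (P.prod P) := by
    refine (hZL.comp_fst P).mono (by fun_prop) (Eventually.of_forall fun w => ?_)
    change ‖η w * L w.1‖ ≤ ‖Z w.1 * L w.1‖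
    rw [norm_mul (η w), norm_mul (Z w.1)]
    refine mul_le_mul_of_nonneg_right ?_ (norm_nonneg _)
    rw [norm_eq_abs, norm_of_nonneg (hZ.nonneg _)]
    exact hη1 w
  have hsL : ∫ q, s q * L q ∂P = ∫ w, η w * L w.1 ∂(P.prod P) := by
    rw [integral_prod _ hηL]
    simp only [hs, integral_mul_const]
  have i2 : Integrable (fun w => η w * L w.2) (P.prod P) := by
    have h := (hσ.integrable_comp_emb hσe).2 hηL
    refine h.congr (Eventually.of_forall fun w => ?_)
    simp only [Function.comp, hησ, Prod.fst_swap]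
  have e2 : ∫ w, η w * L w.2 ∂(P.prod P) = ∫ w, η w * L w.1 ∂(P.prod P) := by
    rw [← hσ.integral_comp hσe]
    simp only [hησ, Prod.snd_swap]
  have hex : ∀ f : (X × Y) × (X × Y) → ℝ, Integrable (fun w => η w * f w) (P.prod P) →
      Integrable (fun w => η w * f (exchangeSnd w)) (P.prod P) ∧
      ∫ w, η w * f (exchangeSnd w) ∂(P.prod P) = - ∫ w, η w * f w ∂(P.prod P) := by
    intro f hf
    have h : ∀ w, η w * f (exchangeSnd w) =
        - (η (exchangeSnd w) * f (exchangeSnd w)) := fun w => by rw [hητ]; ring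
    simp only [h]
    refine ⟨((hτ.integrable_comp_emb hτe).2 hf).neg, ?_⟩
    rw [integral_neg, hτ.integral_comp hτe fun w => η w * f w]
  obtain ⟨i3, e3⟩ := hex (fun w => L w.1) hηL
  obtain ⟨i4, e4⟩ := hex (fun w => L w.2) i2
  have hηD : (fun w => M w * |D w|) =
      fun w => η w * L w.1 + η w * L w.2 - η w * L (exchangeSnd w).1 -
        η w * L (exchangeSnd w).2 := by
    funext w
    have h1 : η w * D w = M w * |D w| := by
      simp only [hη]
      rw [mul_right_comm, sign_mul_self, mul_comm]
    rw [← h1, hD, doubleDiff]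
    ring
  have i12 : Integrable (fun w => η w * L w.1 + η w * L w.2) (P.prod P) := hηL.add i2
  have i123 : Integrable (fun w => η w * L w.1 + η w * L w.2 - η w * L (exchangeSnd w).1)
    (P.prod P) := i12.sub i3
  have hMD_i : Integrable (fun w => M w * |D w|) (P.prod P) := by
    rw [hηD]
    exact i123.sub i4
  have hMD0 : ∀ w, 0 ≤ M w * |D w| := fun w => mul_nonneg (hM0 w) (abs_nonneg _)
  have hMD : ∫ w, M w * |D w| ∂(P.prod P) = 0 := by
    refine le_antisymm ?_ (integral_nonneg hMD0)
    rw [hηD, integral_sub i123 i4, integral_sub i12 i3, integral_add hηL i2, e3, e4, e2, ← hsL]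
    linarith
  have hMD' := (integral_eq_zero_iff_of_nonneg hMD0 hMD_i).1 hMD
  have p1 : ∀ᵐ w ∂(P.prod P), 0 < Z w.1 := Measure.quasiMeasurePreserving_fst.ae hZ0
  have p2 : ∀ᵐ w ∂(P.prod P), 0 < Z w.2 := Measure.quasiMeasurePreserving_snd.ae hZ0
  filter_upwards [p1, p2, hτ.quasiMeasurePreserving.ae p1, hτ.quasiMeasurePreserving.ae p2,
    hMD'] with w h1 h2 h3 h4 h5
  have hMw : 0 < M w := lt_min (lt_min h1 h2) (lt_min h3 h4)
  exact abs_eq_zero.1 ((mul_eq_zero.1 h5).resolve_left hMw.ne')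

theorem exists_unique_gibbs_coupling (hκ : Measurable κ) (hκi : Integrable κ (μ.prod ν))
    (hκe : Integrable (fun q => exp (κ q)) (μ.prod ν)) :
    ∃ (Z : X × Y → ℝ) (a : X → ℝ) (b : Y → ℝ), IsCouplingDensity μ ν Z ∧
      Measurable a ∧ Measurable b ∧ (∀ᵐ q ∂(μ.prod ν), Z q = exp (κ q + a q.1 + b q.2)) ∧
      Integrable (fun q => entInt (κ q) (Z q)) (μ.prod ν) ∧
      ∀ W, IsCouplingDensity μ ν W → Integrable (fun q => entInt (κ q) (W q)) (μ.prod ν) →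
        ∫ q, entInt (κ q) (Z q) ∂(μ.prod ν) ≤ ∫ q, entInt (κ q) (W q) ∂(μ.prod ν) ∧
        (∫ q, entInt (κ q) (W q) ∂(μ.prod ν) ≤ ∫ q, entInt (κ q) (Z q) ∂(μ.prod ν) →
          W =ᵐ[μ.prod ν] Z) := by
  obtain ⟨Z, hZ, hEZ, hmin⟩ := exists_isCouplingDensity_minimizer hκ hκi hκe
  have hZ0 : ∀ᵐ q ∂(μ.prod ν), 0 < Z q := by
    refine ae_pos_of_entInt_le_segment hκ hκi hκe hZ.measurable hZ.nonneg hEZ fun e he he1 hi => ?_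
    have h := hZ.combine isCouplingDensity_one (sub_nonneg.2 he1.le) he.le (sub_add_cancel 1 e)
    simp only [mul_one] at h
    exact hmin _ h hi
  obtain ⟨a, b, ha, hb, hab⟩ := exists_add_of_doubleDiff_eq_zero
    (by have := hZ.measurable; fun_prop) (doubleDiff_eq_zero_of_minimizer hκ hκe hZ hZ0 hEZ hmin)
  refine ⟨Z, a, b, hZ, ha, hb, ?_, hEZ, fun W hW hEW =>
    ⟨hmin W hW hEW, hZ.ae_eq_of_entInt_le hκ hW hEZ hEW hmin⟩⟩
  filter_upwards [hab, hZ0] with q hq h0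
  rw [add_assoc, ← hq, add_sub_cancel, exp_log h0]

end ProductForm

section Entropy

variable {α : Type*} [MeasurableSpace α]

lemma integrable_log_rnDeriv_of_relEnt_ne_top {q r : Measure α} (h : relEnt q r ≠ ⊤) :
    q ≪ r ∧ Integrable (fun x => log ((q.rnDeriv r x).toReal)) q := by
  by_contra hc
  exact h (if_neg hc)

lemma log_rnDeriv_withDensity_withDensity {R P : Measure α} [SigmaFinite R] {D ℓ W : α → ℝ}
    (hD : Measurable D) (hP : P = R.withDensity fun q => ENNReal.ofReal (D q))
    (hℓ : ∀ᵐ q ∂P, D q = exp (-ℓ q)) (hW : Measurable W) :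
    ∀ᵐ q ∂(P.withDensity fun q => ENNReal.ofReal (W q)),
      log (((P.withDensity fun q => ENNReal.ofReal (W q)).rnDeriv R q).toReal) =
        log (W q) - ℓ q := by
  have hWm : Measurable fun q => ENNReal.ofReal (W q) := hW.ennreal_ofReal
  have hDm : Measurable fun q => ENNReal.ofReal (D q) := hD.ennreal_ofReal
  have hac : P.withDensity (fun q => ENNReal.ofReal (W q)) ≪ P :=
    withDensity_absolutelyContinuous _ _
  have hPR : P ≪ R := hP ▸ withDensity_absolutelyContinuous _ _
  have hrn : (P.withDensity fun q => ENNReal.ofReal (W q)).rnDeriv R =ᵐ[R]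
      fun q => ENNReal.ofReal (D q) * ENNReal.ofReal (W q) := by
    rw [hP, ← withDensity_mul _ hDm hWm]
    exact Measure.rnDeriv_withDensity _ (hDm.mul hWm)
  have hpos : ∀ᵐ q ∂(P.withDensity fun q => ENNReal.ofReal (W q)), ENNReal.ofReal (W q) ≠ 0 := by
    rw [ae_withDensity_iff hWm]
    exact Eventually.of_forall fun _ h => h
  filter_upwards [(hac.trans hPR).ae_le hrn, hpos, hac.ae_le hℓ] with q h1 h2 h3
  have hWq : 0 < W q := by simpa using h2
  rw [h1, ENNReal.toReal_mul, ENNReal.toReal_ofReal hWq.le, h3,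
    ENNReal.toReal_ofReal (exp_pos _).le, log_mul (exp_pos _).ne' hWq.ne', log_exp]
  ring

lemma relEnt_withDensity_withDensity {R P : Measure α} [SigmaFinite R] {D ℓ W : α → ℝ}
    (hD : Measurable D) (hP : P = R.withDensity fun q => ENNReal.ofReal (D q))
    (hℓ : ∀ᵐ q ∂P, D q = exp (-ℓ q)) (hW : Measurable W) (hW0 : ∀ q, 0 ≤ W q) :
    (Integrable (fun q => W q * (log (W q) - ℓ q)) P →
      relEnt (P.withDensity fun q => ENNReal.ofReal (W q)) R =
        ((∫ q, W q * (log (W q) - ℓ q) ∂P : ℝ) : EReal)) ∧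
    (¬ Integrable (fun q => W q * (log (W q) - ℓ q)) P →
      relEnt (P.withDensity fun q => ENNReal.ofReal (W q)) R = ⊤) := by
  have hWm : Measurable fun q => ENNReal.ofReal (W q) := hW.ennreal_ofReal
  have hPR : P ≪ R := hP ▸ withDensity_absolutelyContinuous _ _
  have hac := (withDensity_absolutelyContinuous P fun q => ENNReal.ofReal (W q)).trans hPR
  have hlog := log_rnDeriv_withDensity_withDensity hD hP hℓ hW
  have hlt : ∀ᵐ q ∂P, ENNReal.ofReal (W q) < ∞ :=
    Eventually.of_forall fun _ => ENNReal.ofReal_lt_top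
  have hiff : Integrable (fun q => log (((P.withDensity fun q => ENNReal.ofReal (W q)).rnDeriv
      R q).toReal)) (P.withDensity fun q => ENNReal.ofReal (W q)) ↔
      Integrable (fun q => W q * (log (W q) - ℓ q)) P := by
    rw [integrable_congr hlog, integrable_withDensity_iff_integrable_smul' hWm hlt]
    simp only [ENNReal.toReal_ofReal (hW0 _), smul_eq_mul]
  have hint := integral_withDensity_eq_integral_toReal_smul hWm hlt fun q => log (W q) - ℓ q
  simp only [ENNReal.toReal_ofReal (hW0 _), smul_eq_mul] at hint
  refine ⟨fun h => ?_, fun h => ?_⟩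
  · rw [relEnt, if_pos ⟨hac, hiff.2 h⟩, integral_congr_ae hlog, hint]
  · rw [relEnt, if_neg fun hc => h (hiff.1 hc.2)]

end Entropy

section CouplingMeasure

variable {X Y : Type*} [MeasurableSpace X] [MeasurableSpace Y] {μ : Measure X} {ν : Measure Y}
  {W : X × Y → ℝ}

lemma IsCouplingDensity.isProbabilityMeasure [IsProbabilityMeasure μ]
    (hW : IsCouplingDensity μ ν W) :
    IsProbabilityMeasure ((μ.prod ν).withDensity fun q => ENNReal.ofReal (W q)) := by
  constructor
  rw [withDensity_apply _ MeasurableSet.univ, Measure.restrict_univ,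
    ← ofReal_integral_eq_lintegral_ofReal hW.integrable (Eventually.of_forall hW.nonneg),
    hW.integral_eq_one, ENNReal.ofReal_one]

lemma IsCouplingDensity.map_fst [IsProbabilityMeasure μ] (hW : IsCouplingDensity μ ν W) :
    ((μ.prod ν).withDensity fun q => ENNReal.ofReal (W q)).map Prod.fst = μ := by
  ext s hs
  rw [Measure.map_apply measurable_fst hs, withDensity_apply _ (measurable_fst hs),
    ← ofReal_integral_eq_lintegral_ofReal hW.integrable.integrableOn
      (Eventually.of_forall hW.nonneg), hW.fst s hs, ofReal_measureReal]

lemma IsCouplingDensity.map_snd [IsProbabilityMeasure ν] (hW : IsCouplingDensity μ ν W) :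
    ((μ.prod ν).withDensity fun q => ENNReal.ofReal (W q)).map Prod.snd = ν := by
  ext s hs
  rw [Measure.map_apply measurable_snd hs, withDensity_apply _ (measurable_snd hs),
    ← ofReal_integral_eq_lintegral_ofReal hW.integrable.integrableOn
      (Eventually.of_forall hW.nonneg), hW.snd s hs, ofReal_measureReal]

lemma isCouplingDensity_toReal_rnDeriv [SFinite μ] [SFinite ν] [SigmaFinite (μ.prod ν)]
    {pl : Measure (X × Y)} [IsFiniteMeasure pl]
    (h1 : pl.map Prod.fst = μ) (h2 : pl.map Prod.snd = ν) (hac : pl ≪ μ.prod ν) :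
    IsCouplingDensity μ ν fun q => (pl.rnDeriv (μ.prod ν) q).toReal where
  measurable := (Measure.measurable_rnDeriv _ _).ennreal_toReal
  nonneg _ := ENNReal.toReal_nonneg
  integrable := Measure.integrable_toReal_rnDeriv
  fst A hA := by
    rw [Measure.setIntegral_toReal_rnDeriv hac, ← h1, map_measureReal_apply measurable_fst hA]
  snd B hB := by
    rw [Measure.setIntegral_toReal_rnDeriv hac, ← h2, map_measureReal_apply measurable_snd hB]

lemma withDensity_ofReal_toReal_rnDeriv {α : Type*} [MeasurableSpace α] {P pl : Measure α}
    [SigmaFinite P] [IsFiniteMeasure pl] (hac : pl ≪ P) :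
    (P.withDensity fun q => ENNReal.ofReal (pl.rnDeriv P q).toReal) = pl := by
  refine (withDensity_congr_ae ?_).trans (Measure.withDensity_rnDeriv_eq _ _ hac)
  filter_upwards [Measure.rnDeriv_lt_top pl P] with q hq
  exact ENNReal.ofReal_toReal hq.ne

lemma IsCouplingDensity.integrable_mul_fst [IsProbabilityMeasure μ]
    (hW : IsCouplingDensity μ ν W) {g : X → ℝ} (hg : Integrable g μ) :
    Integrable (fun q => W q * g q.1) (μ.prod ν) ∧
      ∫ q, W q * g q.1 ∂(μ.prod ν) = ∫ x, g x ∂μ := by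
  have hWm : Measurable fun q => ENNReal.ofReal (W q) := hW.measurable.ennreal_ofReal
  have hlt : ∀ᵐ q ∂(μ.prod ν), ENNReal.ofReal (W q) < ∞ :=
    Eventually.of_forall fun _ => ENNReal.ofReal_lt_top
  have hiff := integrable_withDensity_iff_integrable_smul' hWm hlt (g := fun q => g q.1)
  have hint := integral_withDensity_eq_integral_toReal_smul hWm hlt fun q => g q.1
  simp only [ENNReal.toReal_ofReal (hW.nonneg _), smul_eq_mul] at hiff hint
  have hg' := hg
  rw [← hW.map_fst] at hg'
  rw [← hiff, ← hint]
  refine ⟨hg'.comp_measurable measurable_fst, ?_⟩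
  rw [← integral_map measurable_fst.aemeasurable hg'.aestronglyMeasurable, hW.map_fst]

lemma IsCouplingDensity.integrable_mul_snd [IsProbabilityMeasure ν]
    (hW : IsCouplingDensity μ ν W) {g : Y → ℝ} (hg : Integrable g ν) :
    Integrable (fun q => W q * g q.2) (μ.prod ν) ∧
      ∫ q, W q * g q.2 ∂(μ.prod ν) = ∫ y, g y ∂ν := by
  have hWm : Measurable fun q => ENNReal.ofReal (W q) := hW.measurable.ennreal_ofReal
  have hlt : ∀ᵐ q ∂(μ.prod ν), ENNReal.ofReal (W q) < ∞ :=
    Eventually.of_forall fun _ => ENNReal.ofReal_lt_top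
  have hiff := integrable_withDensity_iff_integrable_smul' hWm hlt (g := fun q => g q.2)
  have hint := integral_withDensity_eq_integral_toReal_smul hWm hlt fun q => g q.2
  simp only [ENNReal.toReal_ofReal (hW.nonneg _), smul_eq_mul] at hiff hint
  have hg' := hg
  rw [← hW.map_snd] at hg'
  rw [← hiff, ← hint]
  refine ⟨hg'.comp_measurable measurable_snd, ?_⟩
  rw [← integral_map measurable_snd.aemeasurable hg'.aestronglyMeasurable, hW.map_snd]

/-- The entropy of a coupling relative to `R` is, up to a constant, a Bregman divergence. -/
lemma IsCouplingDensity.relEnt_eq [IsProbabilityMeasure μ] [IsProbabilityMeasure ν]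
    {R : Measure (X × Y)} [SigmaFinite R] {D ℓ : X × Y → ℝ} {b₁ : X → ℝ} {b₂ : Y → ℝ}
    (hD : Measurable D) (hP : μ.prod ν = R.withDensity fun q => ENNReal.ofReal (D q))
    (hℓ : ∀ᵐ q ∂(μ.prod ν), D q = exp (-ℓ q)) (hb₁ : Integrable b₁ μ) (hb₂ : Integrable b₂ ν)
    (hκe : Integrable (fun q => exp (ℓ q - b₁ q.1 - b₂ q.2)) (μ.prod ν))
    (hW : IsCouplingDensity μ ν W) :
    (Integrable (fun q => entInt (ℓ q - b₁ q.1 - b₂ q.2) (W q)) (μ.prod ν) →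
      relEnt ((μ.prod ν).withDensity fun q => ENNReal.ofReal (W q)) R =
        ((∫ q, entInt (ℓ q - b₁ q.1 - b₂ q.2) (W q) ∂(μ.prod ν) -
          (∫ q, exp (ℓ q - b₁ q.1 - b₂ q.2) ∂(μ.prod ν) + ∫ x, b₁ x ∂μ + ∫ y, b₂ y ∂ν - 1) :
            ℝ) : EReal)) ∧
    (¬ Integrable (fun q => entInt (ℓ q - b₁ q.1 - b₂ q.2) (W q)) (μ.prod ν) →
      relEnt ((μ.prod ν).withDensity fun q => ENNReal.ofReal (W q)) R = ⊤) := by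
  obtain ⟨i1, e1⟩ := hW.integrable_mul_fst hb₁
  obtain ⟨i2, e2⟩ := hW.integrable_mul_snd hb₂
  have h12 : Integrable (fun q => exp (ℓ q - b₁ q.1 - b₂ q.2) + W q * b₁ q.1) (μ.prod ν) :=
    hκe.add i1
  have h123 : Integrable (fun q => exp (ℓ q - b₁ q.1 - b₂ q.2) + W q * b₁ q.1 + W q * b₂ q.2)
    (μ.prod ν) := h12.add i2
  have hr : Integrable (fun q => exp (ℓ q - b₁ q.1 - b₂ q.2) + W q * b₁ q.1 + W q * b₂ q.2 - W q)
    (μ.prod ν) := h123.sub hW.integrable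
  have hri : ∫ q, (exp (ℓ q - b₁ q.1 - b₂ q.2) + W q * b₁ q.1 + W q * b₂ q.2 - W q) ∂(μ.prod ν) =
      ∫ q, exp (ℓ q - b₁ q.1 - b₂ q.2) ∂(μ.prod ν) + ∫ x, b₁ x ∂μ + ∫ y, b₂ y ∂ν - 1 := by
    rw [integral_sub h123 hW.integrable, integral_add h12 i2, integral_add hκe i1, e1, e2,
      hW.integral_eq_one]
  have hsplit : (fun q => W q * (log (W q) - ℓ q)) = fun q =>
      entInt (ℓ q - b₁ q.1 - b₂ q.2) (W q) -
        (exp (ℓ q - b₁ q.1 - b₂ q.2) + W q * b₁ q.1 + W q * b₂ q.2 - W q) := by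
    funext q
    unfold entInt
    ring
  obtain ⟨h1, h2⟩ := relEnt_withDensity_withDensity hD hP hℓ hW.measurable hW.nonneg
  rw [hsplit] at h1 h2
  refine ⟨fun h => ?_, fun h => h2 fun hc => h ?_⟩
  · rw [h1 (h.sub hr), integral_sub h hr, hri]
  · refine (hc.add hr).congr (Eventually.of_forall fun q => ?_)
    exact sub_add_cancel _ _

end CouplingMeasure

section Minimizer

variable {X : Type*} [MeasurableSpace X] {μ ν : Measure X}

theorem exists_entCost_minimizer [IsProbabilityMeasure μ] [IsProbabilityMeasure ν]
    {R : Measure (X × X)} [SigmaFinite R] {D ℓ : X × X → ℝ} {b₁ b₂ : X → ℝ}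
    (hD : Measurable D) (hP : μ.prod ν = R.withDensity fun q => ENNReal.ofReal (D q))
    (hDℓ : ∀ᵐ q ∂(μ.prod ν), D q = exp (-ℓ q))
    (hac : ∀ pl : Measure (X × X), pl.map Prod.fst = μ → pl.map Prod.snd = ν → pl ≪ R →
      pl ≪ μ.prod ν)
    (hℓ : Measurable ℓ) (hℓi : Integrable ℓ (μ.prod ν))
    (hb₁ : Measurable b₁) (hb₂ : Measurable b₂) (hb₁i : Integrable b₁ μ) (hb₂i : Integrable b₂ ν)
    (hκe : Integrable (fun q => exp (ℓ q - b₁ q.1 - b₂ q.2)) (μ.prod ν)) :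
    entCost R μ ν ≠ ⊤ ∧ entCost R μ ν ≠ ⊥ ∧
    ∃ (piHat : Measure (X × X)) (a b : X → ℝ), Measurable a ∧ Measurable b ∧
      piHat = (μ.prod ν).withDensity (fun q => ENNReal.ofReal (exp (ℓ q + a q.1 + b q.2))) ∧
      IsProbabilityMeasure piHat ∧ piHat.map Prod.fst = μ ∧ piHat.map Prod.snd = ν ∧
      relEnt piHat R = entCost R μ ν ∧
      ∀ pl : Measure (X × X), IsProbabilityMeasure pl → pl.map Prod.fst = μ →
        pl.map Prod.snd = ν → relEnt pl R = entCost R μ ν → pl = piHat := by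
  have hκ : Measurable fun q => ℓ q - b₁ q.1 - b₂ q.2 := by fun_prop
  have hκi : Integrable (fun q => ℓ q - b₁ q.1 - b₂ q.2) (μ.prod ν) :=
    (hℓi.sub (hb₁i.comp_fst ν)).sub (hb₂i.comp_snd μ)
  obtain ⟨Z, a, b, hZ, ha, hb, hZab, hEZ, hmin⟩ := exists_unique_gibbs_coupling hκ hκi hκe
  set c : ℝ := ∫ q, exp (ℓ q - b₁ q.1 - b₂ q.2) ∂(μ.prod ν) + ∫ x, b₁ x ∂μ + ∫ y, b₂ y ∂ν - 1
  have hent : relEnt ((μ.prod ν).withDensity fun q => ENNReal.ofReal (Z q)) R =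
      ((∫ q, entInt (ℓ q - b₁ q.1 - b₂ q.2) (Z q) ∂(μ.prod ν) - c : ℝ) : EReal) :=
    (hZ.relEnt_eq hD hP hDℓ hb₁i hb₂i hκe).1 hEZ
  have hcoupling : ∀ pl : Measure (X × X), IsProbabilityMeasure pl → pl.map Prod.fst = μ →
      pl.map Prod.snd = ν → relEnt pl R ≠ ⊤ → ∃ W, IsCouplingDensity μ ν W ∧
        Integrable (fun q => entInt (ℓ q - b₁ q.1 - b₂ q.2) (W q)) (μ.prod ν) ∧
        (μ.prod ν).withDensity (fun q => ENNReal.ofReal (W q)) = pl ∧ relEnt pl R =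
          ((∫ q, entInt (ℓ q - b₁ q.1 - b₂ q.2) (W q) ∂(μ.prod ν) - c : ℝ) : EReal) := by
    intro pl _ h1 h2 hfin
    have hplP := hac pl h1 h2 (integrable_log_rnDeriv_of_relEnt_ne_top hfin).1
    have hW := isCouplingDensity_toReal_rnDeriv h1 h2 hplP
    have hpl := withDensity_ofReal_toReal_rnDeriv hplP
    obtain ⟨e1, e2⟩ := hW.relEnt_eq hD hP hDℓ hb₁i hb₂i hκe
    rw [hpl] at e1 e2
    have hEW := not_imp_comm.1 e2 hfin
    exact ⟨_, hW, hEW, hpl, e1 hEW⟩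
  have hcost : relEnt ((μ.prod ν).withDensity fun q => ENNReal.ofReal (Z q)) R =
      entCost R μ ν := by
    refine le_antisymm (le_sInf ?_)
      (sInf_le ⟨_, hZ.isProbabilityMeasure, hZ.map_fst, hZ.map_snd, rfl⟩)
    rintro _ ⟨pl, hpl, h1, h2, rfl⟩
    by_cases hfin : relEnt pl R = ⊤
    · rw [hfin]
      exact le_top
    obtain ⟨W, hW, hEW, -, hrel⟩ := hcoupling pl hpl h1 h2 hfin
    rw [hrel, hent, EReal.coe_le_coe_iff]
    exact sub_le_sub_right (hmin W hW hEW).1 _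
  have hcost' := hcost
  rw [hent] at hcost'
  refine ⟨hcost' ▸ EReal.coe_ne_top _, hcost' ▸ EReal.coe_ne_bot _, _, fun x => a x - b₁ x,
    fun y => b y - b₂ y, ha.sub hb₁, hb.sub hb₂, ?_, hZ.isProbabilityMeasure, hZ.map_fst,
    hZ.map_snd, hcost, fun pl hpl h1 h2 hrel => ?_⟩
  · refine withDensity_congr_ae ?_
    filter_upwards [hZab] with q hq
    rw [hq]
    congr 2
    ring
  · obtain ⟨W, hW, hEW, hWpl, hrelW⟩ := hcoupling pl hpl h1 h2
      (by rw [hrel, ← hcost']; exact EReal.coe_ne_top _)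
    rw [hrelW, ← hcost', EReal.coe_eq_coe_iff] at hrel
    rw [← hWpl]
    refine withDensity_congr_ae ?_
    filter_upwards [(hmin W hW hEW).2 (by linarith)] with q hq
    rw [hq]

end Minimizer

section Kernel

variable {X : Type*} [MeasurableSpace X] {m μ ν : Measure X} {p : X → X → ℝ}

lemma prod_eq_withDensity_mul_toReal_rnDeriv [SigmaFinite m] [IsProbabilityMeasure μ]
    [IsProbabilityMeasure ν] (hμ : μ ≪ m) (hν : ν ≪ m) :
    μ.prod ν = (m.prod m).withDensity fun q =>
      ENNReal.ofReal ((μ.rnDeriv m q.1).toReal * (ν.rnDeriv m q.2).toReal) := by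
  conv_lhs => rw [← withDensity_ofReal_toReal_rnDeriv hμ, ← withDensity_ofReal_toReal_rnDeriv hν]
  rw [prod_withDensity (Measure.measurable_rnDeriv _ _).ennreal_toReal.ennreal_ofReal
    (Measure.measurable_rnDeriv _ _).ennreal_toReal.ennreal_ofReal]
  simp only [ENNReal.ofReal_mul ENNReal.toReal_nonneg]

lemma ae_toReal_rnDeriv_pos [SigmaFinite m] [IsFiniteMeasure μ] (hμ : μ ≪ m) :
    ∀ᵐ x ∂μ, 0 < (μ.rnDeriv m x).toReal := by
  filter_upwards [Measure.rnDeriv_pos hμ, hμ.ae_le (Measure.rnDeriv_lt_top μ m)] with x h1 h2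
  exact ENNReal.toReal_pos h1.ne' h2.ne

theorem exists_entCost_minimizer_of_kernel [SigmaFinite m] [IsProbabilityMeasure μ]
    [IsProbabilityMeasure ν] (hp : Measurable fun q : X × X => p q.1 q.2) {A B : X → ℝ}
    (hB : Measurable B) (hA0 : ∀ x, 0 ≤ A x)
    (hpA : ∀ x y, exp (-A x - A y) ≤ p x y)
    (hpB : Integrable (fun q : X × X => exp (-B q.1 - B q.2) * p q.1 q.2) (m.prod m))
    (hAμ : Integrable A μ) (hAν : Integrable A ν) (hBμ : Integrable B μ) (hBν : Integrable B ν)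
    (hμ : μ ≪ m) (hν : ν ≪ m) (hμl : Integrable (fun x => log (μ.rnDeriv m x).toReal) μ)
    (hνl : Integrable (fun x => log (ν.rnDeriv m x).toReal) ν)
    {R : Measure (X × X)} (hR : R = (m.prod m).withDensity fun q => ENNReal.ofReal (p q.1 q.2)) :
    entCost R μ ν ≠ ⊤ ∧ entCost R μ ν ≠ ⊥ ∧
    ∃ (piHat : Measure (X × X)) (f g : X → ℝ), Measurable f ∧ Measurable g ∧
      (∀ x, 0 ≤ f x) ∧ (∀ x, 0 ≤ g x) ∧
      piHat = R.withDensity (fun q => ENNReal.ofReal (f q.1 * g q.2)) ∧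
      IsProbabilityMeasure piHat ∧ piHat.map Prod.fst = μ ∧ piHat.map Prod.snd = ν ∧
      relEnt piHat R = entCost R μ ν ∧
      ∀ pl : Measure (X × X), IsProbabilityMeasure pl → pl.map Prod.fst = μ →
        pl.map Prod.snd = ν → relEnt pl R = entCost R μ ν → pl = piHat := by
  have hp0 : ∀ x y, 0 < p x y := fun x y => (exp_pos _).trans_le (hpA x y)
  set ρ : X → ℝ := fun x => (μ.rnDeriv m x).toReal
  set σ : X → ℝ := fun x => (ν.rnDeriv m x).toReal
  have hρ : Measurable ρ := (Measure.measurable_rnDeriv _ _).ennreal_toReal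
  have hσ : Measurable σ := (Measure.measurable_rnDeriv _ _).ennreal_toReal
  have hρ0 : ∀ x, 0 ≤ ρ x := fun _ => ENNReal.toReal_nonneg
  have hσ0 : ∀ x, 0 ≤ σ x := fun _ => ENNReal.toReal_nonneg
  have hρpos : ∀ᵐ x ∂μ, 0 < ρ x := ae_toReal_rnDeriv_pos hμ
  have hσpos : ∀ᵐ x ∂ν, 0 < σ x := ae_toReal_rnDeriv_pos hν
  have hρP : ∀ᵐ q ∂(μ.prod ν), 0 < ρ q.1 := Measure.quasiMeasurePreserving_fst.ae hρpos
  have hσP : ∀ᵐ q ∂(μ.prod ν), 0 < σ q.2 := Measure.quasiMeasurePreserving_snd.ae hσpos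
  have hPm : μ.prod ν = (m.prod m).withDensity fun q => ENNReal.ofReal (ρ q.1 * σ q.2) :=
    prod_eq_withDensity_mul_toReal_rnDeriv hμ hν
  have hρσ : Measurable fun q : X × X => ENNReal.ofReal (ρ q.1 * σ q.2) := by fun_prop
  have hsf : SigmaFinite R := hR ▸ SigmaFinite.withDensity_ofReal _
  have hR_withDensity : ∀ u : X × X → ℝ, Measurable u →
      R.withDensity (fun q => ENNReal.ofReal (u q)) =
        (m.prod m).withDensity fun q => ENNReal.ofReal (p q.1 q.2 * u q) := by
    intro u hu
    rw [hR, ← withDensity_mul _ hp.ennreal_ofReal hu.ennreal_ofReal]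
    simp only [Pi.mul_def, ENNReal.ofReal_mul (hp0 _ _).le]
  have hP : μ.prod ν = R.withDensity fun q => ENNReal.ofReal (ρ q.1 * σ q.2 / p q.1 q.2) := by
    rw [hR_withDensity _ (by fun_prop), hPm]
    simp only [mul_div_cancel₀ _ (hp0 _ _).ne']
  have hℓ : Measurable fun q : X × X => log (p q.1 q.2) - log (ρ q.1) - log (σ q.2) := by fun_prop
  have hac : ∀ pl : Measure (X × X), pl.map Prod.fst = μ → pl.map Prod.snd = ν → pl ≪ R →
      pl ≪ μ.prod ν := by
    intro pl h1 h2 hpl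
    refine Measure.AbsolutelyContinuous.mk fun s _ hs0 => ?_
    rw [measure_eq_zero_iff_ae_notMem, hPm, ae_withDensity_iff hρσ] at hs0
    rw [measure_eq_zero_iff_ae_notMem]
    have hRm : R ≪ m.prod m := hR ▸ withDensity_absolutelyContinuous _ _
    rw [← h1] at hρpos
    rw [← h2] at hσpos
    filter_upwards [(hpl.trans hRm).ae_le hs0, ae_of_ae_map measurable_fst.aemeasurable hρpos,
      ae_of_ae_map measurable_snd.aemeasurable hσpos] with q hq h3 h4
    exact hq (ENNReal.ofReal_pos.2 (mul_pos h3 h4)).ne'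
  have hexp : ∀ q : X × X, 0 < ρ q.1 → 0 < σ q.2 → ρ q.1 * σ q.2 *
      exp (log (p q.1 q.2) - log (ρ q.1) - log (σ q.2) - B q.1 - B q.2) =
        exp (-B q.1 - B q.2) * p q.1 q.2 := by
    intro q h1 h2
    rw [show log (p q.1 q.2) - log (ρ q.1) - log (σ q.2) - B q.1 - B q.2 =
      log (p q.1 q.2) - log (ρ q.1) - log (σ q.2) + (-B q.1 - B q.2) by ring, exp_add, exp_sub,
      exp_sub, exp_log (hp0 _ _), exp_log h1, exp_log h2]
    field_simp
  have hκe : Integrable (fun q => exp (log (p q.1 q.2) - log (ρ q.1) - log (σ q.2) - B q.1 -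
      B q.2)) (μ.prod ν) := by
    rw [hPm, integrable_withDensity_iff_integrable_smul' hρσ
      (Eventually.of_forall fun _ => ENNReal.ofReal_lt_top)]
    refine hpB.mono' (Measurable.aestronglyMeasurable (by fun_prop))
      (Eventually.of_forall fun q => ?_)
    rw [ENNReal.toReal_ofReal (mul_nonneg (hρ0 _) (hσ0 _)), smul_eq_mul, norm_of_nonneg
      (mul_nonneg (mul_nonneg (hρ0 _) (hσ0 _)) (exp_pos _).le)]
    rcases (hρ0 q.1).eq_or_lt with h1 | h1
    · rw [← h1, zero_mul, zero_mul]
      exact mul_nonneg (exp_pos _).le (hp0 _ _).le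
    rcases (hσ0 q.2).eq_or_lt with h2 | h2
    · rw [← h2, mul_zero, zero_mul]
      exact mul_nonneg (exp_pos _).le (hp0 _ _).le
    exact (hexp q h1 h2).le
  have hℓi : Integrable (fun q : X × X => log (p q.1 q.2) - log (ρ q.1) - log (σ q.2))
      (μ.prod ν) := by
    have j1 := (hμl.abs.comp_fst ν).add (hνl.abs.comp_snd μ)
    have j2 := (hBμ.abs.comp_fst ν).add (hBν.abs.comp_snd μ)
    have j3 := (hAμ.comp_fst ν).add (hAν.comp_snd μ)
    refine (((hκe.add j2).add j1).add j3).mono' hℓ.aestronglyMeasurable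
      (Eventually.of_forall fun q => ?_)
    have hlow : -A q.1 - A q.2 ≤ log (p q.1 q.2) := (le_log_iff_exp_le (hp0 _ _)).2 (hpA _ _)
    have hup := add_one_le_exp (log (p q.1 q.2) - log (ρ q.1) - log (σ q.2) - B q.1 - B q.2)
    have hup0 := exp_pos (log (p q.1 q.2) - log (ρ q.1) - log (σ q.2) - B q.1 - B q.2)
    have := le_abs_self (log (ρ q.1))
    have := le_abs_self (log (σ q.2))
    have := le_abs_self (B q.1)
    have := le_abs_self (B q.2)
    have := hA0 q.1
    have := hA0 q.2
    have := abs_nonneg (log (ρ q.1))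
    have := abs_nonneg (log (σ q.2))
    have := abs_nonneg (B q.1)
    have := abs_nonneg (B q.2)
    rw [norm_eq_abs, abs_le]
    simp only [Pi.add_apply]
    change _ ≤ _ ∧ _ ≤ exp _ + (|B q.1| + |B q.2|) + (|log (ρ q.1)| + |log (σ q.2)|) +
      (A q.1 + A q.2)
    constructor
    · change -(exp _ + (|B q.1| + |B q.2|) + (|log (ρ q.1)| + |log (σ q.2)|) +
        (A q.1 + A q.2)) ≤ _
      linarith
    · linarith
  have hDℓ : ∀ᵐ q ∂(μ.prod ν), ρ q.1 * σ q.2 / p q.1 q.2 =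
      exp (-(log (p q.1 q.2) - log (ρ q.1) - log (σ q.2))) := by
    filter_upwards [hρP, hσP] with q h1 h2
    rw [show -(log (p q.1 q.2) - log (ρ q.1) - log (σ q.2)) =
      log (ρ q.1) + log (σ q.2) - log (p q.1 q.2) by ring, exp_sub, exp_add, exp_log h1,
      exp_log h2, exp_log (hp0 _ _)]
  obtain ⟨hT, hbot, piHat, a, b, ha, hb, hpi, hprob, hfst, hsnd, hcost, huniq⟩ :=
    exists_entCost_minimizer (by fun_prop) hP hDℓ hac hℓ hℓi hB hB hBμ hBν hκe
  refine ⟨hT, hbot, piHat, {x | 0 < ρ x}.indicator fun x => exp (a x),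
    {x | 0 < σ x}.indicator fun x => exp (b x),
    (by fun_prop : Measurable fun x => exp (a x)).indicator (measurableSet_lt measurable_const hρ),
    (by fun_prop : Measurable fun x => exp (b x)).indicator (measurableSet_lt measurable_const hσ),
    indicator_nonneg fun _ _ => (exp_pos _).le, indicator_nonneg fun _ _ => (exp_pos _).le, ?_,
    hprob, hfst, hsnd, hcost, huniq⟩
  have hfg : Measurable fun q : X × X => ({x | 0 < ρ x}.indicator fun x => exp (a x)) q.1 *
      ({x | 0 < σ x}.indicator fun x => exp (b x)) q.2 :=
    (((by fun_prop : Measurable fun x => exp (a x)).indicator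
      (measurableSet_lt measurable_const hρ)).comp measurable_fst).mul
    (((by fun_prop : Measurable fun x => exp (b x)).indicator
      (measurableSet_lt measurable_const hσ)).comp measurable_snd)
  rw [hR_withDensity _ hfg, hpi, hPm, ← withDensity_mul _ hρσ
    (Measurable.ennreal_ofReal (by fun_prop))]
  congr 1
  funext q
  rw [Pi.mul_apply, ← ENNReal.ofReal_mul (mul_nonneg (hρ0 _) (hσ0 _))]
  congr 1
  rcases (hρ0 q.1).eq_or_lt with h1 | h1
  · rw [indicator_of_notMem (by simp [← h1]), ← h1]
    ring
  rcases (hσ0 q.2).eq_or_lt with h2 | h2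
  · rw [indicator_of_notMem (s := {x | 0 < σ x}) (by simp [← h2]), ← h2]
    ring
  rw [indicator_of_mem (by exact h1), indicator_of_mem (by exact h2), exp_add, exp_add, exp_sub,
    exp_sub, exp_log (hp0 _ _), exp_log h1, exp_log h2]
  field_simp

end Kernel

section Interpolation

variable {X : Type*} [MeasurableSpace X] {m μ ν : Measure X} {p : ℝ → X → X → ℝ} {f g : X → ℝ}

/-- The action of the semigroup on nonnegative functions, with values in `[0, ∞]`. -/
def lsemigroup (m : Measure X) (p : ℝ → X → X → ℝ) (t : ℝ) (f : X → ℝ) (x : X) : ℝ≥0∞ :=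
  if t = 0 then ENNReal.ofReal (f x) else ∫⁻ y, ENNReal.ofReal (f y * p t x y) ∂m

lemma measurable_lsemigroup [SFinite m] {t : ℝ} (hp : Measurable (Function.uncurry (p t)))
    (hf : Measurable f) : Measurable (lsemigroup m p t f) := by
  by_cases ht : t = 0
  · have h : lsemigroup m p t f = fun x => ENNReal.ofReal (f x) := funext fun _ => if_pos ht
    rw [h]
    exact hf.ennreal_ofReal
  · have h : lsemigroup m p t f = fun x => ∫⁻ y, ENNReal.ofReal (f y * p t x y) ∂m :=
      funext fun _ => if_neg ht
    rw [h]
    exact ((hf.comp measurable_snd).mul hp).ennreal_ofReal.lintegral_prod_right'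

lemma lintegral_ofReal_chapman {s t : ℝ} {y z : X}
    (h0 : ∀ t x y, 0 ≤ p t x y) (hpos : 0 < p (s + t) y z)
    (hck : ∫ x, p s y x * p t x z ∂m = p (s + t) y z) :
    ∫⁻ x, ENNReal.ofReal (p s y x) * ENNReal.ofReal (p t x z) ∂m =
      ENNReal.ofReal (p (s + t) y z) := by
  have hi : Integrable (fun x => p s y x * p t x z) m := by
    by_contra hi
    rw [integral_undef hi] at hck
    exact hpos.ne hck
  rw [← hck, ofReal_integral_eq_lintegral_ofReal hi
    (Eventually.of_forall fun x => mul_nonneg (h0 _ _ _) (h0 _ _ _))]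
  simp only [ENNReal.ofReal_mul (h0 _ _ _)]

lemma withDensity_lsemigroup_zero_mul_one [SFinite m] (hp : Measurable (Function.uncurry (p 1)))
    (hf : Measurable f) (hg : Measurable g) (hg0 : ∀ x, 0 ≤ g x) :
    m.withDensity (fun x => lsemigroup m p 0 f x * lsemigroup m p 1 g x) =
      (((m.prod m).withDensity fun q => ENNReal.ofReal (p 1 q.1 q.2)).withDensity
        fun q => ENNReal.ofReal (f q.1 * g q.2)).map Prod.fst := by
  have hp' : Measurable fun q : X × X => p 1 q.1 q.2 := hp
  have hfg : Measurable fun q : X × X => ENNReal.ofReal (f q.1 * g q.2) := by fun_prop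
  ext s hs
  rw [Measure.map_apply measurable_fst hs, ← withDensity_mul _ hp'.ennreal_ofReal hfg,
    withDensity_apply _ hs, withDensity_apply _ (measurable_fst hs), ← prod_univ,
    ← Measure.prod_restrict, Measure.restrict_univ,
    lintegral_prod _ (hp'.ennreal_ofReal.mul hfg).aemeasurable]
  refine lintegral_congr fun x => ?_
  rw [lsemigroup, if_pos rfl, lsemigroup, if_neg one_ne_zero, ← lintegral_const_mul]
  · refine lintegral_congr fun y => ?_
    rw [Pi.mul_apply, ENNReal.ofReal_mul (hg0 y), ENNReal.ofReal_mul' (hg0 y)]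
    ring
  · exact (hg.mul (hp'.comp measurable_prodMk_left)).ennreal_ofReal

lemma withDensity_lsemigroup_one_mul_zero [SFinite m] (hp : Measurable (Function.uncurry (p 1)))
    (hf : Measurable f) (hg : Measurable g) (hf0 : ∀ x, 0 ≤ f x)
    (hsymm : ∀ t x y, p t x y = p t y x) :
    m.withDensity (fun x => lsemigroup m p 1 f x * lsemigroup m p 0 g x) =
      (((m.prod m).withDensity fun q => ENNReal.ofReal (p 1 q.1 q.2)).withDensity
        fun q => ENNReal.ofReal (f q.1 * g q.2)).map Prod.snd := by
  have hp' : Measurable fun q : X × X => p 1 q.1 q.2 := hp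
  have hfg : Measurable fun q : X × X => ENNReal.ofReal (f q.1 * g q.2) := by fun_prop
  ext s hs
  rw [Measure.map_apply measurable_snd hs, ← withDensity_mul _ hp'.ennreal_ofReal hfg,
    withDensity_apply _ hs, withDensity_apply _ (measurable_snd hs), ← univ_prod,
    ← Measure.prod_restrict, Measure.restrict_univ,
    lintegral_prod_symm _ (hp'.ennreal_ofReal.mul hfg).aemeasurable]
  refine lintegral_congr fun x => ?_
  rw [lsemigroup, if_neg one_ne_zero, lsemigroup, if_pos rfl, ← lintegral_mul_const]
  · refine lintegral_congr fun y => ?_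
    rw [Pi.mul_apply, ENNReal.ofReal_mul (hf0 y), ENNReal.ofReal_mul (hf0 y), hsymm]
    ring
  · exact (hf.mul (hp'.comp measurable_prodMk_left)).ennreal_ofReal

lemma lintegral_lsemigroup_mul_lsemigroup [SFinite m]
    (hp : ∀ t, Measurable (Function.uncurry (p t)))
    (hf : Measurable f) (hg : Measurable g) (hf0 : ∀ x, 0 ≤ f x) (hg0 : ∀ x, 0 ≤ g x)
    (h0 : ∀ t x y, 0 ≤ p t x y) (hsymm : ∀ t x y, p t x y = p t y x)
    (hck : ∀ s t, 0 < s → 0 < t → ∀ x y, ∫ z, p s x z * p t z y ∂m = p (s + t) x y)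
    (hpos : ∀ x y, 0 < p 1 x y) {t : ℝ} (ht0 : 0 < t) (ht1 : t < 1) :
    ∫⁻ x, lsemigroup m p t f x * lsemigroup m p (1 - t) g x ∂m =
      (((m.prod m).withDensity fun q => ENNReal.ofReal (p 1 q.1 q.2)).withDensity
        fun q => ENNReal.ofReal (f q.1 * g q.2)) univ := by
  have hp' : ∀ t, Measurable fun q : X × X => p t q.1 q.2 := hp
  have hfg : Measurable fun q : X × X => ENNReal.ofReal (f q.1 * g q.2) := by fun_prop
  have hsplit : ∀ x, lsemigroup m p t f x * lsemigroup m p (1 - t) g x =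
      ∫⁻ q, ENNReal.ofReal (f q.1 * p t x q.1) * ENNReal.ofReal (g q.2 * p (1 - t) x q.2)
        ∂(m.prod m) := by
    intro x
    rw [lsemigroup, if_neg ht0.ne', lsemigroup, if_neg (sub_pos.2 ht1).ne']
    refine (lintegral_prod_mul ?_ ?_).symm
    · exact (hf.mul ((hp' t).comp measurable_prodMk_left)).ennreal_ofReal.aemeasurable
    · exact (hg.mul ((hp' (1 - t)).comp measurable_prodMk_left)).ennreal_ofReal.aemeasurable
  have hmeas : Measurable fun w : X × X × X => ENNReal.ofReal (f w.2.1 * p t w.1 w.2.1) *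
      ENNReal.ofReal (g w.2.2 * p (1 - t) w.1 w.2.2) := by
    have m1 : Measurable fun w : X × X × X => p t w.1 w.2.1 :=
      (hp' t).comp (by fun_prop : Measurable fun w : X × X × X => (w.1, w.2.1))
    have m2 : Measurable fun w : X × X × X => p (1 - t) w.1 w.2.2 :=
      (hp' (1 - t)).comp (by fun_prop : Measurable fun w : X × X × X => (w.1, w.2.2))
    fun_prop
  simp only [hsplit]
  rw [lintegral_lintegral_swap hmeas.aemeasurable, ← withDensity_mul _ (hp' 1).ennreal_ofReal hfg,
    withDensity_apply _ MeasurableSet.univ, Measure.restrict_univ]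
  refine lintegral_congr fun q => ?_
  have hadd : t + (1 - t) = 1 := by ring
  have hchap := lintegral_ofReal_chapman h0 (by rw [hadd]; exact hpos q.1 q.2)
    (hck t (1 - t) ht0 (sub_pos.2 ht1) q.1 q.2)
  rw [hadd] at hchap
  rw [Pi.mul_apply, ← hchap, ← lintegral_mul_const]
  · refine lintegral_congr fun x => ?_
    rw [ENNReal.ofReal_mul (hf0 _), ENNReal.ofReal_mul (hg0 _), ENNReal.ofReal_mul (hf0 _),
      hsymm t x]
    ring
  · exact ((hp' t).comp measurable_prodMk_left).ennreal_ofReal.mul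
      ((hp' (1 - t)).comp measurable_prodMk_right).ennreal_ofReal

lemma withDensity_ofReal_toReal_mul {u v : X → ℝ≥0∞} (hu : Measurable u) (hv : Measurable v)
    (h : ∫⁻ x, u x * v x ∂m ≠ ∞) :
    m.withDensity (fun x => ENNReal.ofReal ((u x).toReal * (v x).toReal)) =
      m.withDensity fun x => u x * v x := by
  refine withDensity_congr_ae ?_
  filter_upwards [ae_lt_top (hu.mul hv) h] with x hx
  rw [← ENNReal.toReal_mul]
  exact ENNReal.ofReal_toReal hx.ne

end Interpolation

section Semigroup

variable {n : ℕ} {m : Measure (EuclideanSpace ℝ (Fin n))}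
  {p : ℝ → EuclideanSpace ℝ (Fin n) → EuclideanSpace ℝ (Fin n) → ℝ}
  {f g : EuclideanSpace ℝ (Fin n) → ℝ}

lemma Tsg_eq_toReal_lsemigroup {t : ℝ} (hp : Measurable (Function.uncurry (p t)))
    (h0 : ∀ x y, 0 ≤ p t x y) (hf : Measurable f) (hf0 : ∀ x, 0 ≤ f x)
    (x : EuclideanSpace ℝ (Fin n)) : Tsg n m p t f x = (lsemigroup m p t f x).toReal := by
  unfold Tsg lsemigroup
  split_ifs
  · rw [ENNReal.toReal_ofReal (hf0 x)]
  · refine integral_eq_lintegral_of_nonneg_ae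
      (Eventually.of_forall fun y => mul_nonneg (hf0 y) (h0 x y)) ?_
    exact (hf.mul (hp.comp measurable_prodMk_left)).aestronglyMeasurable

end Semigroup

instance sigmaFinite_mV (n : ℕ) (V : EuclideanSpace ℝ (Fin n) → ℝ) : SigmaFinite (mV n V) :=
  SigmaFinite.withDensity_ofReal _

/-- **Characterization of the entropic minimizer and the entropic interpolation**
(Proposition of Section 3): under (Exi), (Reg1), (Reg2), the entropic cost is finite,
the Schrödinger problem admits a unique minimizing coupling `π̂`, whose density with
respect to `R₀₁` has the product form `f0(x)g1(y)`, where `(f0, g1)` solves the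
Schrödinger system; the entropic interpolation `μ_t = (T_t f0)(T_{1−t} g1)·m` is a flow
of probability measures joining `μ0` to `μ1`. -/
theorem schroedinger_minimizer_and_entropic_interpolation (n : ℕ) (hn : 0 < n)
    (V : EuclideanSpace ℝ (Fin n) → ℝ) (hV : ContDiff ℝ 2 V) (hExi : Exi n V)
    (p : ℝ → EuclideanSpace ℝ (Fin n) → EuclideanSpace ℝ (Fin n) → ℝ)
    (hKol : IsKolmogorov n V (mV n V) p)
    (μ0 μ1 : Measure (EuclideanSpace ℝ (Fin n)))
    (hμ0 : IsProbabilityMeasure μ0) (hμ1 : IsProbabilityMeasure μ1)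
    (hReg2 : Reg2 n (mV n V) (p 1) μ0 μ1) :
    entCost (R01 n (mV n V) (p 1)) μ0 μ1 ≠ ⊤ ∧
    entCost (R01 n (mV n V) (p 1)) μ0 μ1 ≠ ⊥ ∧
    ∃ piHat : Measure (EuclideanSpace ℝ (Fin n) × EuclideanSpace ℝ (Fin n)),
      (IsProbabilityMeasure piHat ∧ piHat.map Prod.fst = μ0 ∧ piHat.map Prod.snd = μ1 ∧
        relEnt piHat (R01 n (mV n V) (p 1)) = entCost (R01 n (mV n V) (p 1)) μ0 μ1) ∧
      (∀ pl : Measure (EuclideanSpace ℝ (Fin n) × EuclideanSpace ℝ (Fin n)),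
        IsProbabilityMeasure pl → pl.map Prod.fst = μ0 → pl.map Prod.snd = μ1 →
        relEnt pl (R01 n (mV n V) (p 1)) = entCost (R01 n (mV n V) (p 1)) μ0 μ1 →
        pl = piHat) ∧
      ∃ f0 g1 : EuclideanSpace ℝ (Fin n) → ℝ,
        Measurable f0 ∧ Measurable g1 ∧ (∀ x, 0 ≤ f0 x) ∧ (∀ x, 0 ≤ g1 x) ∧
        (∀ᵐ z ∂(R01 n (mV n V) (p 1)),
          ((piHat.rnDeriv (R01 n (mV n V) (p 1)) z).toReal = f0 z.1 * g1 z.2)) ∧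
        (∀ᵐ x ∂(mV n V),
          (μ0.rnDeriv (mV n V) x).toReal = f0 x * Tsg n (mV n V) p 1 g1 x) ∧
        (∀ᵐ x ∂(mV n V),
          (μ1.rnDeriv (mV n V) x).toReal = g1 x * Tsg n (mV n V) p 1 f0 x) ∧
        (∀ t ∈ Set.Icc (0 : ℝ) 1, IsProbabilityMeasure
          ((mV n V).withDensity fun x =>
            ENNReal.ofReal (Tsg n (mV n V) p t f0 x * Tsg n (mV n V) p (1 - t) g1 x))) ∧
        ((mV n V).withDensity fun x =>
            ENNReal.ofReal (Tsg n (mV n V) p 0 f0 x * Tsg n (mV n V) p (1 - 0) g1 x)) = μ0 ∧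
        ((mV n V).withDensity fun x =>
            ENNReal.ofReal (Tsg n (mV n V) p 1 f0 x * Tsg n (mV n V) p (1 - 1) g1 x)) = μ1 := by
  obtain ⟨⟨A, B, hA, hB, hA0, hB0, hpA, hpB, hAB0, hAB1⟩, hent0, hent1⟩ := hReg2
  obtain ⟨hac0, hlog0⟩ := integrable_log_rnDeriv_of_relEnt_ne_top hent0
  obtain ⟨hac1, hlog1⟩ := integrable_log_rnDeriv_of_relEnt_ne_top hent1
  have hdom : ∀ {μ : Measure (EuclideanSpace ℝ (Fin n))}, Integrable (fun x => A x + B x) μ →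
      Integrable A μ ∧ Integrable B μ := fun h =>
    ⟨h.mono' hA.aestronglyMeasurable (Eventually.of_forall fun x => by
        rw [norm_of_nonneg (hA0 x)]; exact le_add_of_nonneg_right (hB0 x)),
      h.mono' hB.aestronglyMeasurable (Eventually.of_forall fun x => by
        rw [norm_of_nonneg (hB0 x)]; exact le_add_of_nonneg_left (hA0 x))⟩
  obtain ⟨hT, hbot, piHat, f, g, hf, hg, hf0, hg0, hpi, hprob, hfst, hsnd, hcost, huniq⟩ :=
    exists_entCost_minimizer_of_kernel (m := mV n V) (p := p 1) (hKol.meas 1) hB hA0 hpA hpB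
      (hdom hAB0).1 (hdom hAB1).1 (hdom hAB0).2 (hdom hAB1).2 hac0 hac1 hlog0 hlog1
      (R := R01 n (mV n V) (p 1)) rfl
  have hpos : ∀ x y, 0 < p 1 x y := fun x y => (exp_pos _).trans_le (hpA x y)
  have hm0 : (mV n V).withDensity
      (fun x => lsemigroup (mV n V) p 0 f x * lsemigroup (mV n V) p 1 g x) = μ0 := by
    rw [withDensity_lsemigroup_zero_mul_one (hKol.meas 1) hf hg hg0, ← hfst, hpi, R01]
  have hm1 : (mV n V).withDensity
      (fun x => lsemigroup (mV n V) p 1 f x * lsemigroup (mV n V) p 0 g x) = μ1 := by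
    rw [withDensity_lsemigroup_one_mul_zero (hKol.meas 1) hf hg hf0 hKol.symm, ← hsnd, hpi, R01]
  have hmass : ∀ t ∈ Icc (0 : ℝ) 1,
      ∫⁻ x, lsemigroup (mV n V) p t f x * lsemigroup (mV n V) p (1 - t) g x ∂(mV n V) = 1 := by
    intro t ht
    rcases ht.1.eq_or_lt with rfl | ht0
    · rw [sub_zero, ← setLIntegral_univ, ← withDensity_apply _ MeasurableSet.univ, hm0,
        measure_univ]
    rcases ht.2.eq_or_lt with rfl | ht1
    · rw [sub_self, ← setLIntegral_univ, ← withDensity_apply _ MeasurableSet.univ, hm1,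
        measure_univ]
    rw [lintegral_lsemigroup_mul_lsemigroup hKol.meas hf hg hf0 hg0 hKol.nonneg hKol.symm
      hKol.chapman hpos ht0 ht1]
    change ((R01 n (mV n V) (p 1)).withDensity _) univ = 1
    rw [← hpi, measure_univ]
  have hTf : ∀ t x, Tsg n (mV n V) p t f x = (lsemigroup (mV n V) p t f x).toReal := fun t =>
    Tsg_eq_toReal_lsemigroup (hKol.meas t) (hKol.nonneg t) hf hf0
  have hTg : ∀ t x, Tsg n (mV n V) p t g x = (lsemigroup (mV n V) p t g x).toReal := fun t =>
    Tsg_eq_toReal_lsemigroup (hKol.meas t) (hKol.nonneg t) hg hg0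
  have hmf : ∀ t, Measurable (lsemigroup (mV n V) p t f) := fun t =>
    measurable_lsemigroup (hKol.meas t) hf
  have hmg : ∀ t, Measurable (lsemigroup (mV n V) p t g) := fun t =>
    measurable_lsemigroup (hKol.meas t) hg
  have hflow : ∀ t ∈ Icc (0 : ℝ) 1, (mV n V).withDensity (fun x =>
      ENNReal.ofReal (Tsg n (mV n V) p t f x * Tsg n (mV n V) p (1 - t) g x)) =
      (mV n V).withDensity
        fun x => lsemigroup (mV n V) p t f x * lsemigroup (mV n V) p (1 - t) g x := by
    intro t ht
    simp only [hTf, hTg]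
    exact withDensity_ofReal_toReal_mul (hmf t) (hmg (1 - t))
      ((hmass t ht).symm ▸ ENNReal.one_ne_top)
  have hfsg : Measurable fun z : EuclideanSpace ℝ (Fin n) × EuclideanSpace ℝ (Fin n) =>
      ENNReal.ofReal (f z.1 * g z.2) := by fun_prop
  have hsf : SigmaFinite (R01 n (mV n V) (p 1)) := SigmaFinite.withDensity_ofReal _
  refine ⟨hT, hbot, piHat, ⟨hprob, hfst, hsnd, hcost⟩, huniq, f, g, hf, hg, hf0, hg0, ?_, ?_, ?_,
    fun t ht => ⟨?_⟩, ?_, ?_⟩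
  · rw [hpi]
    filter_upwards [Measure.rnDeriv_withDensity _ hfsg] with z hz
    rw [hz, ENNReal.toReal_ofReal (mul_nonneg (hf0 _) (hg0 _))]
  · conv in μ0.rnDeriv _ => rw [← hm0]
    filter_upwards [Measure.rnDeriv_withDensity (mV n V) ((hmf 0).mul (hmg 1))] with x hx
    refine (congrArg ENNReal.toReal hx).trans ?_
    rw [Pi.mul_apply, ENNReal.toReal_mul, ← hTf, ← hTg, Tsg, if_pos rfl]
  · conv in μ1.rnDeriv _ => rw [← hm1]
    filter_upwards [Measure.rnDeriv_withDensity (mV n V) ((hmf 1).mul (hmg 0))] with x hx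
    refine (congrArg ENNReal.toReal hx).trans ?_
    rw [Pi.mul_apply, ENNReal.toReal_mul, ← hTf, ← hTg, mul_comm, Tsg, if_pos rfl]
  · rw [hflow t ht, withDensity_apply _ MeasurableSet.univ, setLIntegral_univ, hmass t ht]
  · rw [hflow 0 (left_mem_Icc.2 zero_le_one), sub_zero, hm0]
  · rw [hflow 1 (right_mem_Icc.2 zero_le_one), sub_self, hm1]
end
end

section
/- Rescaled dual formulation of the entropic cost: fix ε, u > 0 and let the hypotheses (Exi), (Reg1) and (Reg2) hold for the kernel p_{εu}. Then ε·A^{R^{εu}}(μ0,μ1) = ε·H(μ0|m) + sup{ ∫ ψ dμ1 − ∫ Q^ε_u ψ dμ0 : ψ ∈ C_b(ℝⁿ) }, where Q^ε_u ψ := ε log T_{εu}(e^{ψ/ε}). -/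
open MeasureTheory Real Filter Set
open scoped ENNReal RealInnerProductSpace Topology

noncomputable section

/-- The Hopf–Lax type semigroup `Q^ε_u ψ = ε log T_{εu}(e^{ψ/ε})`. -/
def Qeps (n : ℕ) (m : Measure (EuclideanSpace ℝ (Fin n)))
    (p : ℝ → EuclideanSpace ℝ (Fin n) → EuclideanSpace ℝ (Fin n) → ℝ)
    (eps u : ℝ) (ψ : EuclideanSpace ℝ (Fin n) → ℝ) (x : EuclideanSpace ℝ (Fin n)) : ℝ :=
  eps * Real.log (Tsg n m p (eps * u) (fun y => Real.exp (ψ y / eps)) x)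

namespace EntropicDuality

open ProbabilityTheory
open scoped BoundedContinuousFunction

/-! ### Two facts on square-integrable functions -/

section SquareIntegrable

variable {Ω : Type*} [MeasurableSpace Ω] {ρ : Measure Ω}

lemma L2_inner_toLp {a b : Ω → ℝ} (ha : MemLp a 2 ρ) (hb : MemLp b 2 ρ) :
    inner ℝ (ha.toLp a) (hb.toLp b) = ∫ z, a z * b z ∂ρ := by
  rw [L2.inner_def]
  refine integral_congr_ae ?_
  filter_upwards [ha.coeFn_toLp, hb.coeFn_toLp] with z h1 h2
  simp [h1, h2, mul_comm]

lemma tendsto_integral_mul_sq {G : ℕ → Ω → ℝ} {g χ : Ω → ℝ} {C : ℝ}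
    (hG : ∀ k, MemLp (G k) 2 ρ) (hg : MemLp g 2 ρ)
    (hlim : Tendsto (fun k => eLpNorm (G k - g) 2 ρ) atTop (𝓝 0))
    (hχ : AEStronglyMeasurable χ ρ) (hC : ∀ z, |χ z| ≤ C) :
    Tendsto (fun k => ∫ z, χ z * G k z ^ 2 ∂ρ) atTop (𝓝 (∫ z, χ z * g z ^ 2 ∂ρ)) := by
  have hχm : ∀ {a : Ω → ℝ}, MemLp a 2 ρ → MemLp (fun z => χ z * a z) 2 ρ := fun {a} ha =>
    ha.of_le_mul (hχ.mul ha.1) (ae_of_all _ fun z => by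
      simpa [abs_mul] using mul_le_mul_of_nonneg_right (hC z) (abs_nonneg (a z)))
  have h1 := (Lp.tendsto_Lp_iff_tendsto_eLpNorm'' G hG g hg).2 hlim
  have h2 := (Lp.tendsto_Lp_iff_tendsto_eLpNorm'' (fi := atTop) (fun k z => χ z * G k z)
    (fun k => hχm (hG k)) (fun z => χ z * g z) (hχm hg)).2 <| by
      have hle : ∀ k, eLpNorm ((fun z => χ z * G k z) - fun z => χ z * g z) 2 ρ ≤
          ENNReal.ofReal C * eLpNorm (G k - g) 2 ρ := fun k => by
        refine eLpNorm_le_mul_eLpNorm_of_ae_le_mul (ae_of_all _ fun z => ?_) 2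
        simp only [Pi.sub_apply, Real.norm_eq_abs, ← mul_sub, abs_mul]
        exact mul_le_mul_of_nonneg_right (hC z) (abs_nonneg _)
      refine tendsto_of_tendsto_of_tendsto_of_le_of_le tendsto_const_nhds ?_
        (fun _ => zero_le) hle
      simpa using ENNReal.Tendsto.const_mul hlim (Or.inr ENNReal.ofReal_ne_top)
  have h3 := h1.inner h2 (𝕜 := ℝ)
  simp only [L2_inner_toLp] at h3
  have e : ∀ a : Ω → ℝ, ∫ z, χ z * a z ^ 2 ∂ρ = ∫ z, a z * (χ z * a z) ∂ρ := fun a =>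
    integral_congr_ae (ae_of_all _ fun z => by simp only []; ring)
  simpa only [e] using h3

lemma exists_tendsto_eLpNorm_two {G : ℕ → Ω → ℝ} (hG : ∀ k, MemLp (G k) 2 ρ)
    (hc : ∀ N k l, N ≤ k → N ≤ l → ∫ z, (G k z - G l z) ^ 2 ∂ρ ≤ 2 * (1 / 4) ^ N) :
    ∃ g, Measurable g ∧ MemLp g 2 ρ ∧
      Tendsto (fun k => eLpNorm (G k - g) 2 ρ) atTop (𝓝 0) := by
  obtain ⟨g, hg, hlim⟩ := Lp.cauchy_complete_eLpNorm (p := 2) (μ := ρ) (by norm_num) hG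
    (B := fun N => ENNReal.ofReal (2 * (1 / 2) ^ N))
    (by
      rw [← ENNReal.ofReal_tsum_of_nonneg (fun N => by positivity)
        (summable_geometric_two.mul_left 2)]
      exact ENNReal.ofReal_ne_top)
    (fun N k l hk hl => by
      rw [((hG k).sub (hG l)).eLpNorm_eq_integral_rpow_norm (by norm_num) (by norm_num)]
      refine (ENNReal.ofReal_lt_ofReal_iff (by positivity)).2 ?_
      have h := hc N k l hk hl
      simp only [Pi.sub_apply, ENNReal.toReal_ofNat, Real.rpow_ofNat, norm_eq_abs, sq_abs]
      rw [← one_div, ← Real.sqrt_eq_rpow]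
      refine (Real.sqrt_lt' (by positivity)).2 (h.trans_lt ?_)
      rw [mul_pow, ← pow_mul, mul_comm N, pow_mul]
      norm_num)
  refine ⟨hg.1.mk g, hg.1.measurable_mk, hg.ae_eq hg.1.ae_eq_mk, ?_⟩
  refine hlim.congr fun k => eLpNorm_congr_ae ?_
  filter_upwards [hg.1.ae_eq_mk] with z hz
  simp [hz]

end SquareIntegrable

/-! ### The dual functional of a Markov kernel -/

section Dual

variable {α β : Type*} [MeasurableSpace α] [MeasurableSpace β] [TopologicalSpace β]

/-- The logarithmic Laplace transform `x ↦ log ∫ e^φ dκ_x`. -/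
def logLaplace (κ : Kernel α β) (φ : β →ᵇ ℝ) (x : α) : ℝ :=
  Real.log (∫ y, Real.exp (φ y) ∂κ x)

/-- The density, with respect to `κ x`, of the probability measure proportional to
`e^φ κ x`. -/
def tilt (κ : Kernel α β) (φ : β →ᵇ ℝ) (z : α × β) : ℝ :=
  Real.exp (φ z.2 - logLaplace κ φ z.1)

/-- The functional `φ ↦ ∫ φ dν - ∫ log κ(e^φ) dμ`. -/
def dualFun (κ : Kernel α β) (μ : Measure α) (ν : Measure β) (φ : β →ᵇ ℝ) : ℝ :=
  ∫ y, φ y ∂ν - ∫ x, logLaplace κ φ x ∂μ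

lemma tilt_pos {κ : Kernel α β} (φ : β →ᵇ ℝ) (z : α × β) : 0 < tilt κ φ z := Real.exp_pos _

lemma logLaplace_zero {κ : Kernel α β} [IsMarkovKernel κ] (x : α) :
    logLaplace κ (0 : β →ᵇ ℝ) x = 0 := by
  simp [logLaplace]

lemma dualFun_zero {κ : Kernel α β} [IsMarkovKernel κ] {μ : Measure α} {ν : Measure β} :
    dualFun κ μ ν (0 : β →ᵇ ℝ) = 0 := by
  simp [dualFun, logLaplace_zero]

variable [BorelSpace β] {κ : Kernel α β} [IsMarkovKernel κ]
  {μ : Measure α} {ν : Measure β} [IsProbabilityMeasure μ] [IsProbabilityMeasure ν]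

lemma integrable_exp_bcf (ρ : Measure β) [IsFiniteMeasure ρ] (φ : β →ᵇ ℝ) :
    Integrable (fun y => Real.exp (φ y)) ρ := by
  refine Integrable.of_bound (C := Real.exp ‖φ‖) ?_ (ae_of_all _ fun y => ?_)
  · exact (Real.measurable_exp.comp φ.continuous.measurable).aestronglyMeasurable
  · simpa using (le_abs_self _).trans (φ.norm_coe_le_norm y)

lemma integral_exp_bcf_pos (φ : β →ᵇ ℝ) (x : α) : 0 < ∫ y, Real.exp (φ y) ∂κ x :=
  integral_exp_pos (integrable_exp_bcf _ φ)

lemma exp_logLaplace (φ : β →ᵇ ℝ) (x : α) :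
    Real.exp (logLaplace κ φ x) = ∫ y, Real.exp (φ y) ∂κ x :=
  Real.exp_log (integral_exp_bcf_pos φ x)

lemma logLaplace_le_add (φ θ : β →ᵇ ℝ) (x : α) :
    logLaplace κ φ x ≤ logLaplace κ θ x + ‖φ - θ‖ := by
  rw [← Real.exp_le_exp, Real.exp_add, exp_logLaplace, exp_logLaplace, ← integral_mul_const]
  refine integral_mono (integrable_exp_bcf _ φ) ((integrable_exp_bcf _ θ).mul_const _)
    fun y => ?_
  simp only [← Real.exp_add, Real.exp_le_exp]
  have := (le_abs_self _).trans ((φ - θ).norm_coe_le_norm y)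
  simp only [BoundedContinuousFunction.coe_sub, Pi.sub_apply] at this
  linarith

lemma abs_logLaplace_le (φ : β →ᵇ ℝ) (x : α) : |logLaplace κ φ x| ≤ ‖φ‖ := by
  have h1 := logLaplace_le_add (κ := κ) φ 0 x
  have h2 := logLaplace_le_add (κ := κ) 0 φ x
  simp only [logLaplace_zero, sub_zero, zero_sub, norm_neg] at h1 h2
  exact abs_le.2 ⟨by linarith, by linarith⟩

lemma measurable_logLaplace (φ : β →ᵇ ℝ) : Measurable (logLaplace κ φ) := by
  refine Real.measurable_log.comp (StronglyMeasurable.measurable ?_)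
  exact StronglyMeasurable.integral_kernel_prod_right' (κ := κ)
    (f := fun z : α × β => Real.exp (φ z.2))
    (Real.measurable_exp.comp (φ.continuous.measurable.comp measurable_snd)).stronglyMeasurable

lemma integrable_logLaplace (φ : β →ᵇ ℝ) : Integrable (logLaplace κ φ) μ :=
  Integrable.of_bound (measurable_logLaplace φ).aestronglyMeasurable ‖φ‖
    (ae_of_all _ fun x => abs_logLaplace_le φ x)

lemma dualFun_le_add (φ θ : β →ᵇ ℝ) :
    dualFun κ μ ν φ ≤ dualFun κ μ ν θ + 2 * ‖φ - θ‖ := by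
  have h1 : ∫ y, φ y ∂ν ≤ ∫ y, (θ y + ‖φ - θ‖) ∂ν := by
    refine integral_mono (φ.integrable ν) ((θ.integrable ν).add (integrable_const _)) fun y => ?_
    have := (le_abs_self _).trans ((φ - θ).norm_coe_le_norm y)
    simp only [BoundedContinuousFunction.coe_sub, Pi.sub_apply] at this
    linarith
  have h2 : ∫ x, logLaplace κ θ x ∂μ ≤ ∫ x, (logLaplace κ φ x + ‖φ - θ‖) ∂μ := by
    refine integral_mono (integrable_logLaplace θ)
      ((integrable_logLaplace φ).add (integrable_const _)) fun x => ?_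
    rw [← norm_sub_rev θ φ]
    exact logLaplace_le_add θ φ x
  rw [integral_add (θ.integrable ν) (integrable_const _)] at h1
  rw [integral_add (integrable_logLaplace φ) (integrable_const _)] at h2
  simp only [integral_const, probReal_univ, smul_eq_mul, one_mul] at h1 h2
  unfold dualFun
  linarith

lemma continuous_dualFun : Continuous (dualFun κ μ ν) := by
  refine (LipschitzWith.of_dist_le_mul (K := 2) fun φ θ => ?_).continuous
  have h1 := dualFun_le_add (κ := κ) (μ := μ) (ν := ν) φ θ
  have h2 := dualFun_le_add (κ := κ) (μ := μ) (ν := ν) θ φ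
  rw [norm_sub_rev] at h2
  rw [Real.dist_eq, dist_eq_norm, abs_le]
  push_cast
  constructor <;> linarith

lemma measurable_tilt (φ : β →ᵇ ℝ) : Measurable (tilt κ φ) :=
  Real.measurable_exp.comp ((φ.continuous.measurable.comp measurable_snd).sub
    ((measurable_logLaplace φ).comp measurable_fst))

lemma tilt_le (φ : β →ᵇ ℝ) (z : α × β) : tilt κ φ z ≤ Real.exp (2 * ‖φ‖) := by
  refine Real.exp_le_exp.2 ?_
  have h1 := (le_abs_self _).trans (φ.norm_coe_le_norm z.2)
  have h2 := (neg_abs_le _).trans' (neg_le_neg (abs_logLaplace_le (κ := κ) φ z.1))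
  linarith

lemma integrable_mul_tilt {Ω : Type*} [MeasurableSpace Ω] {ρ : Measure Ω} [IsFiniteMeasure ρ]
    {χ : Ω → ℝ} (hχ : Integrable χ ρ) {e : Ω → α × β} (he : Measurable e) (φ : β →ᵇ ℝ) :
    Integrable (fun w => χ w * tilt κ φ (e w)) ρ := by
  refine hχ.mul_bdd (c := Real.exp (2 * ‖φ‖))
    ((measurable_tilt φ).comp he).aestronglyMeasurable (ae_of_all _ fun w => ?_)
  simpa [abs_of_pos (tilt_pos φ (e w))] using tilt_le φ (e w)

lemma integral_exp_mul_tilt (φ θ : β →ᵇ ℝ) (x : α) :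
    ∫ y, Real.exp (θ y) * tilt κ φ (x, y) ∂κ x =
      Real.exp (logLaplace κ (φ + θ) x - logLaplace κ φ x) := by
  rw [Real.exp_sub, exp_logLaplace, div_eq_mul_inv, ← integral_mul_const]
  refine integral_congr_ae (ae_of_all _ fun y => ?_)
  simp only [tilt, ← Real.exp_neg, ← Real.exp_add, BoundedContinuousFunction.coe_add, Pi.add_apply]
  ring_nf

lemma integral_tilt (φ : β →ᵇ ℝ) (x : α) : ∫ y, tilt κ φ (x, y) ∂κ x = 1 := by
  simpa using integral_exp_mul_tilt (κ := κ) φ 0 x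

lemma integrable_compProd_mul_tilt {χ : α × β → ℝ} (hχ : Integrable χ (μ ⊗ₘ κ)) (φ : β →ᵇ ℝ) :
    Integrable (fun z => χ z * tilt κ φ z) (μ ⊗ₘ κ) :=
  integrable_mul_tilt hχ measurable_id φ

lemma integral_fst_mul_tilt {χ : α → ℝ} (hχ : Integrable χ μ) (φ : β →ᵇ ℝ) :
    ∫ z, χ z.1 * tilt κ φ z ∂(μ ⊗ₘ κ) = ∫ x, χ x ∂μ := by
  have hχ' : Integrable (fun z : α × β => χ z.1) (μ ⊗ₘ κ) := by
    refine Integrable.comp_measurable (f := Prod.fst) (g := χ) ?_ measurable_fst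
    have : (μ ⊗ₘ κ).map Prod.fst = μ := Measure.fst_compProd μ κ
    rwa [this]
  rw [Measure.integral_compProd (integrable_compProd_mul_tilt hχ' φ)]
  simp [integral_const_mul, integral_tilt]

/-- First order expansion of the dual functional. -/
lemma dualFun_add_ge (φ θ : β →ᵇ ℝ) (hθ : ‖θ‖ ≤ 1) :
    ∫ y, θ y ∂ν - ∫ z, θ z.2 * tilt κ φ z ∂(μ ⊗ₘ κ) - ‖θ‖ ^ 2 ≤
      dualFun κ μ ν (φ + θ) - dualFun κ μ ν φ := by
  have hθm : Measurable θ := θ.continuous.measurable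
  have hθi : Integrable (fun z : α × β => θ z.2) (μ ⊗ₘ κ) :=
    Integrable.of_bound (hθm.comp measurable_snd).aestronglyMeasurable ‖θ‖
      (ae_of_all _ fun z => θ.norm_coe_le_norm z.2)
  have hi := integrable_compProd_mul_tilt (κ := κ) hθi φ
  have key : ∀ x, logLaplace κ (φ + θ) x ≤
      logLaplace κ φ x + (∫ y, θ y * tilt κ φ (x, y) ∂κ x) + ‖θ‖ ^ 2 := fun x => by
    have h1 := Real.add_one_le_exp (logLaplace κ (φ + θ) x - logLaplace κ φ x)
    rw [← integral_exp_mul_tilt φ θ x] at h1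
    have hii := integrable_mul_tilt (κ := κ) (θ.integrable (κ x))
      (measurable_prodMk_left (x := x)) φ
    have ht := integrable_mul_tilt (κ := κ) (integrable_const (μ := κ x) (1 : ℝ))
      (measurable_prodMk_left (x := x)) φ
    have ht2 := integrable_mul_tilt (κ := κ) (integrable_const (μ := κ x) (1 + ‖θ‖ ^ 2))
      (measurable_prodMk_left (x := x)) φ
    have h2 : ∫ y, Real.exp (θ y) * tilt κ φ (x, y) ∂κ x ≤
        ∫ y, ((1 + ‖θ‖ ^ 2) * tilt κ φ (x, y) + θ y * tilt κ φ (x, y)) ∂κ x := by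
      refine integral_mono (integrable_mul_tilt (integrable_exp_bcf _ θ)
        measurable_prodMk_left φ) (ht2.add hii) fun y => ?_
      simp only [← add_mul]
      refine mul_le_mul_of_nonneg_right ?_ (tilt_pos φ _).le
      have hy := θ.norm_coe_le_norm y
      rw [Real.norm_eq_abs] at hy
      have h3 := (abs_le.1 (Real.abs_exp_sub_one_sub_id_le (hy.trans hθ))).2
      have h4 : θ y ^ 2 ≤ ‖θ‖ ^ 2 := sq_le_sq' (by linarith [(abs_le.1 hy).1]) (abs_le.1 hy).2
      linarith
    rw [integral_add ht2 hii, integral_const_mul, integral_tilt] at h2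
    linarith
  have hI : Integrable (fun x => ∫ y, θ y * tilt κ φ (x, y) ∂κ x) μ :=
    hi.integral_compProd
  have h5 := integral_mono (integrable_logLaplace (μ := μ) (φ + θ))
    (((integrable_logLaplace φ).add hI).add (integrable_const (‖θ‖ ^ 2))) key
  rw [integral_add' ((integrable_logLaplace φ).add hI) (integrable_const _),
    integral_add' (integrable_logLaplace φ) hI, ← Measure.integral_compProd hi] at h5
  simp only [integral_const, probReal_univ, smul_eq_mul, one_mul] at h5
  have h6 : ∫ y, (φ + θ) y ∂ν = ∫ y, φ y ∂ν + ∫ y, θ y ∂ν := by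
    simpa using integral_add (φ.integrable ν) (θ.integrable ν)
  unfold dualFun
  rw [h6]
  linarith

/-- Strong concavity of the dual functional in terms of the Hellinger distance. -/
lemma integral_sqrt_tilt_sub_sq_le (φ θ : β →ᵇ ℝ) :
    ∫ z, (√(tilt κ φ z) - √(tilt κ θ z)) ^ 2 ∂(μ ⊗ₘ κ) ≤
      2 * dualFun κ μ ν ((1 / 2 : ℝ) • (φ + θ)) - dualFun κ μ ν φ - dualFun κ μ ν θ := by
  set a : β →ᵇ ℝ := (1 / 2 : ℝ) • (φ + θ) with ha
  set w : α → ℝ := fun x => logLaplace κ a x -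
    (1 / 2) * (logLaplace κ φ x + logLaplace κ θ x) with hw
  have hwi : Integrable w μ := (integrable_logLaplace a).sub
    (((integrable_logLaplace φ).add (integrable_logLaplace θ)).const_mul _)
  have hwm : Measurable w := (measurable_logLaplace a).sub
    (((measurable_logLaplace φ).add (measurable_logLaplace θ)).const_mul _)
  have hwei : Integrable (fun x => Real.exp (w x)) μ := by
    refine Integrable.of_bound (C := Real.exp (‖a‖ + (1 / 2) * (‖φ‖ + ‖θ‖)))
      (Real.measurable_exp.comp hwm).aestronglyMeasurable (ae_of_all _ fun x => ?_)
    have h1 := abs_le.1 (abs_logLaplace_le (κ := κ) a x)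
    have h2 := abs_le.1 (abs_logLaplace_le (κ := κ) φ x)
    have h3 := abs_le.1 (abs_logLaplace_le (κ := κ) θ x)
    simp only [Real.norm_eq_abs, Real.abs_exp, Real.exp_le_exp, hw]
    linarith
  have hprod : ∀ z, (√(tilt κ φ z) - √(tilt κ θ z)) ^ 2 =
      1 * tilt κ φ z + 1 * tilt κ θ z - 2 * (Real.exp (w z.1) * tilt κ a z) := fun z => by
    have h1 : √(tilt κ φ z) * √(tilt κ θ z) = Real.exp (w z.1) * tilt κ a z := by
      rw [← Real.sqrt_mul (tilt_pos φ z).le]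
      simp only [tilt, ← Real.exp_add]
      rw [← Real.exp_half]
      congr 1
      simp only [hw, ha, BoundedContinuousFunction.coe_smul, BoundedContinuousFunction.coe_add,
        Pi.add_apply, smul_eq_mul]
      ring
    rw [sub_sq, Real.sq_sqrt (tilt_pos φ z).le, Real.sq_sqrt (tilt_pos θ z).le, mul_assoc, h1]
    ring
  have hc : Integrable (fun _ : α × β => (1 : ℝ)) (μ ⊗ₘ κ) := integrable_const _
  have hwe' : Integrable (fun z : α × β => Real.exp (w z.1)) (μ ⊗ₘ κ) := by
    refine Integrable.comp_measurable (f := Prod.fst) (g := fun x => Real.exp (w x)) ?_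
      measurable_fst
    have : (μ ⊗ₘ κ).map Prod.fst = μ := Measure.fst_compProd μ κ
    rwa [this]
  have i1 := integrable_compProd_mul_tilt (κ := κ) hc φ
  have i2 := integrable_compProd_mul_tilt (κ := κ) hc θ
  have i3 := (integrable_compProd_mul_tilt (κ := κ) hwe' a).const_mul 2
  have e1 := integral_fst_mul_tilt (κ := κ) (integrable_const (μ := μ) (1 : ℝ)) φ
  have e2 := integral_fst_mul_tilt (κ := κ) (integrable_const (μ := μ) (1 : ℝ)) θ
  have e3 := integral_fst_mul_tilt (κ := κ) hwei a
  simp only [hprod]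
  have i12 : Integrable (fun z => 1 * tilt κ φ z + 1 * tilt κ θ z) (μ ⊗ₘ κ) := i1.add i2
  rw [integral_sub i12 i3, integral_add i1 i2, e1, e2, integral_const_mul, e3]
  have h4 : ∫ x, (w x + 1) ∂μ ≤ ∫ x, Real.exp (w x) ∂μ :=
    integral_mono (hwi.add (integrable_const _)) hwei fun x => Real.add_one_le_exp _
  rw [integral_add hwi (integrable_const _)] at h4
  have h5 : ∫ x, w x ∂μ = ∫ x, logLaplace κ a x ∂μ -
      (1 / 2) * (∫ x, logLaplace κ φ x ∂μ + ∫ x, logLaplace κ θ x ∂μ) := by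
    have hs : Integrable (fun x => logLaplace κ φ x + logLaplace κ θ x) μ :=
      (integrable_logLaplace φ).add (integrable_logLaplace θ)
    simp only [hw]
    rw [integral_sub (integrable_logLaplace a) (hs.const_mul _), integral_const_mul,
      integral_add (integrable_logLaplace φ) (integrable_logLaplace θ)]
  have h6 : ∫ y, a y ∂ν = (1 / 2) * (∫ y, φ y ∂ν + ∫ y, θ y ∂ν) := by
    rw [← integral_add (φ.integrable ν) (θ.integrable ν), ← integral_const_mul]
    rfl
  simp only [integral_const, probReal_univ, smul_eq_mul, one_mul] at h4 ⊢
  unfold dualFun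
  rw [h6]
  linarith

lemma nonpos_of_forall_mul_le_sq_mul {a c t₀ : ℝ} (ht₀ : 0 < t₀)
    (h : ∀ t, 0 < t → t ≤ t₀ → t * a ≤ t ^ 2 * c) : a ≤ 0 := by
  have h0 : Tendsto (fun t : ℝ => t * c) (𝓝[>] 0) (𝓝 0) := by
    have : Tendsto (fun t : ℝ => t * c) (𝓝 0) (𝓝 (0 * c)) := tendsto_id.mul_const c
    rw [zero_mul] at this
    exact this.mono_left nhdsWithin_le_nhds
  refine ge_of_tendsto h0 ?_
  filter_upwards [Ioc_mem_nhdsGT ht₀] with t ht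
  have := h t ht.1 ht.2
  rw [sq, mul_assoc] at this
  exact le_of_mul_le_mul_left this ht.1

/-- Along the ray through any `ψ` there is a `φ` at which the dual functional is at least as
large, and at which its derivative in the direction `φ` is nonnegative. -/
lemma exists_dualFun_ge_of_ray (ψ : β →ᵇ ℝ) :
    ∃ φ : β →ᵇ ℝ, dualFun κ μ ν ψ ≤ dualFun κ μ ν φ ∧
      ∫ z, φ z.2 * tilt κ φ z ∂(μ ⊗ₘ κ) ≤ ∫ y, φ y ∂ν := by
  obtain ⟨s, hs, hmax⟩ := isCompact_Icc.exists_isMaxOn (nonempty_Icc.2 (zero_le_one' ℝ))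
    ((continuous_dualFun (κ := κ) (μ := μ) (ν := ν)).comp
      (continuous_id.smul (continuous_const (y := ψ)))).continuousOn
  refine ⟨s • ψ, by simpa using hmax (right_mem_Icc.2 zero_le_one), ?_⟩
  set φ := s • ψ with hφ
  rw [← sub_nonpos]
  refine nonpos_of_forall_mul_le_sq_mul (c := ‖φ‖ ^ 2) (t₀ := 1 / (‖φ‖ + 1)) (by positivity)
    fun t ht htle => ?_
  have ht1 : t * (‖φ‖ + 1) ≤ 1 := (le_div_iff₀ (by positivity)).1 htle
  have htφ : t * ‖φ‖ ≤ 1 := by nlinarith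
  have hnorm : ‖(-t) • φ‖ = t * ‖φ‖ := by rw [norm_smul, norm_neg, Real.norm_of_nonneg ht.le]
  have h1 := dualFun_add_ge (κ := κ) (μ := μ) (ν := ν) φ ((-t) • φ) (hnorm.trans_le htφ)
  have h2 : dualFun κ μ ν (φ + (-t) • φ) ≤ dualFun κ μ ν φ := by
    have hmem : (1 - t) * s ∈ Icc (0 : ℝ) 1 := by
      have : t ≤ 1 := by nlinarith [norm_nonneg φ]
      exact ⟨mul_nonneg (by linarith) hs.1, by nlinarith [hs.1, hs.2]⟩
    have := hmax hmem
    have e : φ + (-t) • φ = ((1 - t) * s) • ψ := by rw [hφ]; module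
    rw [e]
    simpa using this
  rw [hnorm] at h1
  simp only [BoundedContinuousFunction.coe_smul, smul_eq_mul, mul_assoc, integral_const_mul] at h1
  nlinarith

variable [HasOuterApproxClosed β]

/-- Attained strong duality: a probability measure with marginals `μ` and `ν` whose entropy
relative to `μ ⊗ₘ κ` does not exceed the dual value. -/
theorem exists_density_entropy_le (hB : BddAbove (range (dualFun κ μ ν))) :
    ∃ f : α × β → ℝ, Measurable f ∧ (∀ z, 0 ≤ f z) ∧
      ((μ ⊗ₘ κ).withDensity fun z => ENNReal.ofReal (f z)).map Prod.fst = μ ∧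
      ((μ ⊗ₘ κ).withDensity fun z => ENNReal.ofReal (f z)).map Prod.snd = ν ∧
      Integrable (fun z => f z * Real.log (f z)) (μ ⊗ₘ κ) ∧
      ∫ z, f z * Real.log (f z) ∂(μ ⊗ₘ κ) ≤ ⨆ φ, dualFun κ μ ν φ := by
  set S := ⨆ φ, dualFun κ μ ν φ with hS
  have hle : ∀ φ, dualFun κ μ ν φ ≤ S := le_ciSup hB
  have hnear : ∀ k : ℕ, ∃ φ : β →ᵇ ℝ, S - (1 / 4) ^ k ≤ dualFun κ μ ν φ ∧
      ∫ z, φ z.2 * tilt κ φ z ∂(μ ⊗ₘ κ) ≤ ∫ y, φ y ∂ν := fun k => by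
    obtain ⟨ψ, hψ⟩ := exists_lt_of_lt_ciSup
      (show S - (1 / 4) ^ k < ⨆ φ, dualFun κ μ ν φ from sub_lt_self _ (by positivity))
    obtain ⟨φ, h1, h2⟩ := exists_dualFun_ge_of_ray (κ := κ) (μ := μ) (ν := ν) ψ
    exact ⟨φ, hψ.le.trans h1, h2⟩
  choose φ hφ hray using hnear
  have hGsq : ∀ k z, √(tilt κ (φ k) z) ^ 2 = tilt κ (φ k) z := fun k z =>
    Real.sq_sqrt (tilt_pos _ z).le
  have hG : ∀ k, MemLp (fun z => √(tilt κ (φ k) z)) 2 (μ ⊗ₘ κ) := fun k => by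
    refine MemLp.of_bound (C := √(Real.exp (2 * ‖φ k‖)))
      (measurable_tilt (φ k)).sqrt.aestronglyMeasurable (ae_of_all _ fun z => ?_)
    rw [Real.norm_of_nonneg (Real.sqrt_nonneg _)]
    exact Real.sqrt_le_sqrt (tilt_le _ z)
  obtain ⟨g, hgm, hg, hlim⟩ := exists_tendsto_eLpNorm_two hG fun N k l hk hl => by
    have h1 := integral_sqrt_tilt_sub_sq_le (κ := κ) (μ := μ) (ν := ν) (φ k) (φ l)
    have h2 := hle ((1 / 2 : ℝ) • (φ k + φ l))
    have h3 : (1 / 4 : ℝ) ^ k ≤ (1 / 4) ^ N :=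
      pow_le_pow_of_le_one (by norm_num) (by norm_num) hk
    have h4 : (1 / 4 : ℝ) ^ l ≤ (1 / 4) ^ N :=
      pow_le_pow_of_le_one (by norm_num) (by norm_num) hl
    linarith [hφ k, hφ l]
  have hconv : ∀ {χ : α × β → ℝ} {C : ℝ}, Measurable χ → (∀ z, |χ z| ≤ C) →
      Tendsto (fun k => ∫ z, χ z * tilt κ (φ k) z ∂(μ ⊗ₘ κ)) atTop
        (𝓝 (∫ z, χ z * g z ^ 2 ∂(μ ⊗ₘ κ))) := fun {χ C} hχ hC => by
    simpa only [hGsq] using tendsto_integral_mul_sq hG hg hlim hχ.aestronglyMeasurable hC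
  have hgi : Integrable (fun z => g z ^ 2) (μ ⊗ₘ κ) := hg.integrable_sq
  set P := (μ ⊗ₘ κ).withDensity fun z => ENNReal.ofReal (g z ^ 2) with hP
  have hfst : P.map Prod.fst = μ := by
    ext s hs
    have hχ : Measurable (fun z : α × β => s.indicator (fun _ => (1 : ℝ)) z.1) :=
      (measurable_const.indicator hs).comp measurable_fst
    have h1 := hconv (C := 1) hχ fun z => by
      by_cases hz : z.1 ∈ s <;> simp [hz]
    have h2 : ∀ k, ∫ z, s.indicator (fun _ => (1 : ℝ)) z.1 * tilt κ (φ k) z ∂(μ ⊗ₘ κ) =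
        μ.real s := fun k => by
      rw [integral_fst_mul_tilt ((integrable_const _).indicator hs), integral_indicator_const _ hs]
      simp
    simp only [h2] at h1
    have h3 := tendsto_nhds_unique h1 tendsto_const_nhds
    have h4 : ∀ z : α × β, s.indicator (fun _ => (1 : ℝ)) z.1 * g z ^ 2 =
        (Prod.fst ⁻¹' s).indicator (fun z => g z ^ 2) z := fun z => by
      by_cases hz : z.1 ∈ s <;> simp [indicator, hz]
    simp only [h4] at h3
    rw [integral_indicator (measurable_fst hs)] at h3
    rw [Measure.map_apply measurable_fst hs, hP, withDensity_apply _ (measurable_fst hs),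
      ← ofReal_integral_eq_lintegral_ofReal hgi.integrableOn (ae_of_all _ fun z => sq_nonneg _),
      h3, ofReal_measureReal]
  have hprob : IsProbabilityMeasure P := ⟨by
    have := measure_univ (μ := μ)
    rwa [← hfst, Measure.map_apply measurable_fst MeasurableSet.univ, preimage_univ] at this⟩
  have hsnd_le : ∀ θ : β →ᵇ ℝ, ∫ y, θ y ∂ν ≤ ∫ z, θ z.2 * g z ^ 2 ∂(μ ⊗ₘ κ) := fun θ => by
    have h1 := hconv (C := ‖θ‖) (θ.continuous.measurable.comp measurable_snd)
      fun z => θ.norm_coe_le_norm z.2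
    rw [← sub_nonpos]
    refine nonpos_of_forall_mul_le_sq_mul (c := ‖θ‖ ^ 2) (t₀ := 1 / (‖θ‖ + 1)) (by positivity)
      fun t ht htle => ?_
    have ht1 : t * (‖θ‖ + 1) ≤ 1 := (le_div_iff₀ (by positivity)).1 htle
    have hnorm : ‖t • θ‖ = t * ‖θ‖ := by rw [norm_smul, Real.norm_of_nonneg ht.le]
    have h2 : Tendsto (fun k : ℕ => (1 / 4 : ℝ) ^ k + t ^ 2 * ‖θ‖ ^ 2) atTop
        (𝓝 (0 + t ^ 2 * ‖θ‖ ^ 2)) :=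
      (tendsto_pow_atTop_nhds_zero_of_lt_one (by norm_num) (by norm_num)).add_const _
    rw [zero_add] at h2
    refine le_of_tendsto_of_tendsto' ((h1.const_sub (∫ y, θ y ∂ν)).const_mul t) h2 fun k => ?_
    have h3 := dualFun_add_ge (κ := κ) (μ := μ) (ν := ν) (φ k) (t • θ)
      (hnorm.trans_le (by linarith))
    have h4 := hle (φ k + t • θ)
    rw [hnorm] at h3
    simp only [BoundedContinuousFunction.coe_smul, smul_eq_mul, mul_assoc, integral_const_mul]
      at h3
    have h5 := hφ k
    simp only [Function.comp_apply]
    nlinarith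
  have hsnd : P.map Prod.snd = ν := by
    have : IsProbabilityMeasure (P.map Prod.snd) :=
      Measure.isProbabilityMeasure_map measurable_snd.aemeasurable
    refine ext_of_forall_integral_eq_of_IsFiniteMeasure fun θ => ?_
    rw [integral_map measurable_snd.aemeasurable θ.continuous.measurable.aestronglyMeasurable, hP,
      integral_withDensity_eq_integral_toReal_smul (hgm.pow_const 2).ennreal_ofReal
        (ae_of_all _ fun _ => ENNReal.ofReal_lt_top)]
    simp only [ENNReal.toReal_ofReal (sq_nonneg _), smul_eq_mul, mul_comm (g _ ^ 2)]
    refine le_antisymm ?_ (hsnd_le θ)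
    have := hsnd_le (-θ)
    simp only [BoundedContinuousFunction.coe_neg, Pi.neg_apply, neg_mul, integral_neg] at this
    linarith
  have hent : ∀ k, Integrable (fun z => tilt κ (φ k) z * Real.log (tilt κ (φ k) z)) (μ ⊗ₘ κ) ∧
      ∫ z, tilt κ (φ k) z * Real.log (tilt κ (φ k) z) ∂(μ ⊗ₘ κ) ≤ S := fun k => by
    have hφm := (φ k).continuous.measurable
    have i0 : Integrable (fun z : α × β => φ k z.2) (μ ⊗ₘ κ) :=
      Integrable.of_bound (hφm.comp measurable_snd).aestronglyMeasurable ‖φ k‖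
        (ae_of_all _ fun z => (φ k).norm_coe_le_norm z.2)
    have j0 : Integrable (fun z : α × β => logLaplace κ (φ k) z.1) (μ ⊗ₘ κ) :=
      Integrable.of_bound ((measurable_logLaplace (φ k)).comp measurable_fst).aestronglyMeasurable
        ‖φ k‖ (ae_of_all _ fun z => abs_logLaplace_le _ z.1)
    have i1 := integrable_compProd_mul_tilt i0 (φ k)
    have j1 := integrable_compProd_mul_tilt j0 (φ k)
    have he : ∀ z, tilt κ (φ k) z * Real.log (tilt κ (φ k) z) =
        φ k z.2 * tilt κ (φ k) z - logLaplace κ (φ k) z.1 * tilt κ (φ k) z := fun z => by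
      rw [← sub_mul, mul_comm]
      congr 1
      exact Real.log_exp _
    simp only [he]
    refine ⟨i1.sub j1, ?_⟩
    rw [integral_sub i1 j1, integral_fst_mul_tilt (integrable_logLaplace _)]
    exact (sub_le_sub_right (hray k) _).trans (hle (φ k))
  obtain ⟨ns, -, hae⟩ := (tendstoInMeasure_of_tendsto_eLpNorm (by norm_num)
    (fun k => (hG k).1) hg.1 hlim).exists_seq_tendsto_ae
  have hbdd : ∀ a : ℝ, 0 ≤ a → 0 ≤ a * Real.log a + 1 := fun a ha => by
    linarith [Real.self_sub_one_le_mul_log ha]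
  have hmeas : ∀ f : α × β → ℝ, Measurable f →
      Measurable fun z => f z * Real.log (f z) + 1 := fun f hf =>
    (hf.mul (Real.measurable_log.comp hf)).add_const 1
  have hfatou : ∫⁻ z, ENNReal.ofReal (g z ^ 2 * Real.log (g z ^ 2) + 1) ∂(μ ⊗ₘ κ) ≤
      ENNReal.ofReal (S + 1) := by
    calc _ = ∫⁻ z, liminf (fun i => ENNReal.ofReal (tilt κ (φ (ns i)) z *
            Real.log (tilt κ (φ (ns i)) z) + 1)) atTop ∂(μ ⊗ₘ κ) := by
          refine lintegral_congr_ae ?_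
          filter_upwards [hae] with z hz
          refine (Tendsto.liminf_eq ?_).symm
          have h1 := hz.pow 2
          simp only [hGsq] at h1
          exact ENNReal.tendsto_ofReal
            (((Real.continuous_mul_log.tendsto _).comp h1).add_const 1)
      _ ≤ liminf (fun i => ∫⁻ z, ENNReal.ofReal (tilt κ (φ (ns i)) z *
            Real.log (tilt κ (φ (ns i)) z) + 1) ∂(μ ⊗ₘ κ)) atTop :=
          lintegral_liminf_le fun i => (hmeas _ (measurable_tilt _)).ennreal_ofReal
      _ ≤ ENNReal.ofReal (S + 1) := by
          refine liminf_le_of_le (by isBoundedDefault) fun b hb => ?_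
          obtain ⟨i, hi⟩ := hb.exists
          refine hi.trans ?_
          have hi1 : Integrable (fun z => tilt κ (φ (ns i)) z *
              Real.log (tilt κ (φ (ns i)) z) + 1) (μ ⊗ₘ κ) :=
            (hent (ns i)).1.add (integrable_const 1)
          rw [← ofReal_integral_eq_lintegral_ofReal hi1
            (ae_of_all _ fun z => hbdd _ (tilt_pos _ z).le),
            integral_add (hent (ns i)).1 (integrable_const 1)]
          refine ENNReal.ofReal_le_ofReal ?_
          simpa using (hent (ns i)).2
  have hS0 : 0 ≤ S := by simpa [dualFun_zero] using hle 0
  have hint1 : Integrable (fun z => g z ^ 2 * Real.log (g z ^ 2) + 1) (μ ⊗ₘ κ) := by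
    refine ⟨(hmeas _ (hgm.pow_const 2)).aestronglyMeasurable, ?_⟩
    rw [hasFiniteIntegral_iff_ofReal (ae_of_all _ fun z => hbdd _ (sq_nonneg _))]
    exact hfatou.trans_lt ENNReal.ofReal_lt_top
  have hint : Integrable (fun z => g z ^ 2 * Real.log (g z ^ 2)) (μ ⊗ₘ κ) := by
    refine (hint1.sub (integrable_const (1 : ℝ))).congr (ae_of_all _ fun z => ?_)
    simp only [Pi.sub_apply]
    ring
  refine ⟨fun z => g z ^ 2, hgm.pow_const 2, fun z => sq_nonneg _, hfst, hsnd, hint, ?_⟩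
  rw [← ofReal_integral_eq_lintegral_ofReal hint1 (ae_of_all _ fun z => hbdd _ (sq_nonneg _)),
    ENNReal.ofReal_le_ofReal_iff (by linarith), integral_add hint (integrable_const 1)] at hfatou
  simp only [integral_const, probReal_univ, smul_eq_mul, one_mul] at hfatou
  linarith

end Dual

/-! ### Relative entropy with respect to a reference measure of density type -/

lemma relEnt_eq_of_ne_top {Ω : Type*} [MeasurableSpace Ω] {q r : Measure Ω}
    (h : relEnt q r ≠ ⊤) : q ≪ r ∧ Integrable (fun x => Real.log (q.rnDeriv r x).toReal) q ∧
      relEnt q r = ((∫ x, Real.log (q.rnDeriv r x).toReal ∂q : ℝ) : EReal) := by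
  unfold relEnt at h ⊢
  split_ifs at h ⊢ with hc
  · exact ⟨hc.1, hc.2, rfl⟩
  · exact absurd rfl h

lemma relEnt_of_ac {Ω : Type*} [MeasurableSpace Ω] {q r : Measure Ω} (hac : q ≪ r)
    (hi : Integrable (fun x => Real.log (q.rnDeriv r x).toReal) q) :
    relEnt q r = ((∫ x, Real.log (q.rnDeriv r x).toReal ∂q : ℝ) : EReal) :=
  if_pos ⟨hac, hi⟩

lemma toReal_rnDeriv_pos {α : Type*} [MeasurableSpace α] {μ m : Measure α}
    [IsFiniteMeasure μ] [SigmaFinite m] (hac : μ ≪ m) : ∀ᵐ x ∂μ, 0 < (μ.rnDeriv m x).toReal := by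
  filter_upwards [Measure.rnDeriv_pos hac, hac.ae_le (Measure.rnDeriv_lt_top μ m)] with x h1 h2
  exact ENNReal.toReal_pos h1.ne' h2.ne

lemma integral_comp_of_map_eq {Ω α : Type*} [MeasurableSpace Ω] [MeasurableSpace α]
    {P : Measure Ω} {μ : Measure α} {e : Ω → α} (he : Measurable e) (h : P.map e = μ)
    {f : α → ℝ} (hf : AEStronglyMeasurable f μ) : ∫ z, f (e z) ∂P = ∫ x, f x ∂μ := by
  subst h
  exact (integral_map he.aemeasurable hf).symm

/-- Lower bound on the relative entropy by the log-integral of a subprobability density. -/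
lemma integral_log_le_integral_log_rnDeriv {Ω : Type*} [MeasurableSpace Ω] {P r : Measure Ω}
    [IsProbabilityMeasure P] [SigmaFinite r] (hac : P ≪ r)
    (hlog : Integrable (fun z => Real.log (P.rnDeriv r z).toReal) P) {w : Ω → ℝ}
    (hw : Measurable w) (hwpos : ∀ᵐ z ∂P, 0 < w z) (hw1 : ∫⁻ z, ENNReal.ofReal (w z) ∂r ≤ 1)
    (hwlog : Integrable (fun z => Real.log (w z)) P) :
    ∫ z, Real.log (w z) ∂P ≤ ∫ z, Real.log (P.rnDeriv r z).toReal ∂P := by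
  set h : Ω → ℝ := fun z => (P.rnDeriv r z).toReal with hh
  have hm : Measurable h := (Measure.measurable_rnDeriv P r).ennreal_toReal
  have hpos : ∀ᵐ z ∂P, 0 < h z :=
    toReal_rnDeriv_pos hac
  have hq : ∫⁻ z, ENNReal.ofReal (|w z| / h z) ∂P ≤ 1 := by
    have h1 : ∫⁻ z, ENNReal.ofReal (|w z| / h z) ∂P = ∫⁻ z, ENNReal.ofReal (w z / h z) ∂P :=
      lintegral_congr_ae (by filter_upwards [hwpos] with z hz; rw [abs_of_pos hz])
    have hmeas' : Measurable fun z => ENNReal.ofReal (w z / h z) := (hw.div hm).ennreal_ofReal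
    rw [h1, ← lintegral_rnDeriv_mul hac hmeas'.aemeasurable]
    refine (lintegral_mono_ae ?_).trans hw1
    filter_upwards [Measure.rnDeriv_lt_top P r] with z hz
    rw [← ENNReal.ofReal_toReal hz.ne, ← ENNReal.ofReal_mul ENNReal.toReal_nonneg]
    rcases eq_or_ne (h z) 0 with h0 | h0
    · simp only [hh] at h0
      simp [h0]
    · refine (congrArg ENNReal.ofReal ?_).le
      exact mul_div_cancel₀ _ h0
  have hqnn : 0 ≤ᵐ[P] fun z => |w z| / h z :=
    ae_of_all _ fun z => div_nonneg (abs_nonneg _) ENNReal.toReal_nonneg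
  have hqi : Integrable (fun z => |w z| / h z) P :=
    ⟨(hw.abs.div hm).aestronglyMeasurable, by
      rw [hasFiniteIntegral_iff_ofReal hqnn]; exact hq.trans_lt ENNReal.one_lt_top⟩
  have hq1 : ∫ z, |w z| / h z ∂P ≤ 1 := by
    rw [← ofReal_integral_eq_lintegral_ofReal hqi hqnn] at hq
    simpa using ENNReal.ofReal_le_one.1 hq
  have key : ∫ z, (Real.log (w z) - Real.log (h z)) ∂P ≤ ∫ z, (|w z| / h z - 1) ∂P := by
    refine integral_mono_ae (hwlog.sub hlog) (hqi.sub (integrable_const _)) ?_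
    filter_upwards [hwpos, hpos] with z h1 h2
    rw [abs_of_pos h1, ← Real.log_div h1.ne' h2.ne']
    exact Real.log_le_sub_one_of_pos (div_pos h1 h2)
  rw [integral_sub hwlog hlog, integral_sub hqi (integrable_const _)] at key
  simp only [integral_const, probReal_univ, smul_eq_mul, one_mul] at key
  linarith

section Reference

variable {α : Type*} [MeasurableSpace α] {m : Measure α} {p : α → α → ℝ}

/-- The kernel with density `p x` with respect to `m`. -/
def densityKernel (m : Measure α) [SFinite m] (p : α → α → ℝ) : Kernel α α :=
  (Kernel.const α m).withDensity fun x y => ENNReal.ofReal (p x y)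

/-- The measure `m(dx) p(x,y) m(dy)`. -/
def refMeasure (m : Measure α) (p : α → α → ℝ) : Measure (α × α) :=
  (m.prod m).withDensity fun z => ENNReal.ofReal (p z.1 z.2)

instance [SigmaFinite m] : SigmaFinite (refMeasure m p) :=
  SigmaFinite.withDensity_ofReal _

variable [SigmaFinite m]

lemma densityKernel_apply (hp : Measurable (Function.uncurry p)) (x : α) :
    densityKernel m p x = m.withDensity fun y => ENNReal.ofReal (p x y) := by
  rw [densityKernel, Kernel.withDensity_apply _ hp.ennreal_ofReal, Kernel.const_apply]

lemma isMarkovKernel_densityKernel (hp : Measurable (Function.uncurry p))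
    (hp0 : ∀ x y, 0 ≤ p x y) (hp1 : ∀ x, ∫ y, p x y ∂m = 1) :
    IsMarkovKernel (densityKernel m p) := ⟨fun x => ⟨by
  have hi : Integrable (p x) m := by
    by_contra h
    simpa [integral_undef h] using hp1 x
  rw [densityKernel_apply hp, withDensity_apply _ MeasurableSet.univ, Measure.restrict_univ,
    ← ofReal_integral_eq_lintegral_ofReal hi (ae_of_all _ (hp0 x)), hp1, ENNReal.ofReal_one]⟩⟩

lemma integral_densityKernel (hp : Measurable (Function.uncurry p)) (hp0 : ∀ x y, 0 ≤ p x y)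
    (f : α → ℝ) (x : α) : ∫ y, f y ∂densityKernel m p x = ∫ y, f y * p x y ∂m := by
  have hpx : Measurable fun y => ENNReal.ofReal (p x y) :=
    (hp.comp measurable_prodMk_left).ennreal_ofReal
  rw [densityKernel_apply hp, integral_withDensity_eq_integral_toReal_smul hpx
    (ae_of_all _ fun _ => ENNReal.ofReal_lt_top)]
  simp [ENNReal.toReal_ofReal (hp0 _ _), mul_comm]

lemma compProd_densityKernel (hp : Measurable (Function.uncurry p)) {μ : Measure α}
    [IsFiniteMeasure μ] [IsSFiniteKernel (densityKernel m p)] (hμ : μ ≪ m) :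
    μ ⊗ₘ densityKernel m p = (refMeasure m p).withDensity fun z => μ.rnDeriv m z.1 := by
  have hr : Measurable fun z : α × α => μ.rnDeriv m z.1 :=
    (Measure.measurable_rnDeriv μ m).comp measurable_fst
  have hp' : Measurable fun z : α × α => ENNReal.ofReal (p z.1 z.2) := hp.ennreal_ofReal
  have hpx : ∀ x, Measurable fun y => ENNReal.ofReal (p x y) := fun x =>
    hp'.comp measurable_prodMk_left
  refine Measure.ext_of_lintegral _ fun f hf => ?_
  have hfx : ∀ x, Measurable fun y => f (x, y) := fun x => hf.comp measurable_prodMk_left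
  have hinner : ∀ x, ∫⁻ y, f (x, y) ∂densityKernel m p x =
      ∫⁻ y, ENNReal.ofReal (p x y) * f (x, y) ∂m := fun x => by
    rw [densityKernel_apply hp, lintegral_withDensity_eq_lintegral_mul _ (hpx x) (hfx x)]
    rfl
  have hpf : Measurable fun z : α × α => ENNReal.ofReal (p z.1 z.2) * f z := hp'.mul hf
  rw [Measure.lintegral_compProd hf, lintegral_withDensity_eq_lintegral_mul _ hr hf, refMeasure,
    lintegral_withDensity_eq_lintegral_mul _ hp' (hr.mul hf),
    lintegral_prod _ (hp'.mul (hr.mul hf)).aemeasurable]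
  simp only [hinner]
  rw [← lintegral_rnDeriv_mul hμ hpf.lintegral_prod_right'.aemeasurable]
  refine lintegral_congr fun x => ?_
  have hpfx : Measurable fun y => ENNReal.ofReal (p x y) * f (x, y) := (hpx x).mul (hfx x)
  rw [← lintegral_const_mul _ hpfx]
  refine lintegral_congr fun y => ?_
  simp only [Pi.mul_apply]
  ring

variable [TopologicalSpace α] [BorelSpace α] {μ ν : Measure α}
  [IsProbabilityMeasure μ] [IsProbabilityMeasure ν] [IsMarkovKernel (densityKernel m p)]

/-- Weak duality. -/
lemma add_dualFun_le_relEnt (hp : Measurable (Function.uncurry p)) (hμ : relEnt μ m ≠ ⊤)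
    {P : Measure (α × α)} [IsProbabilityMeasure P] (hfst : P.map Prod.fst = μ)
    (hsnd : P.map Prod.snd = ν) (φ : α →ᵇ ℝ) :
    ((∫ x, Real.log (μ.rnDeriv m x).toReal ∂μ + dualFun (densityKernel m p) μ ν φ : ℝ) : EReal) ≤
      relEnt P (refMeasure m p) := by
  by_cases htop : relEnt P (refMeasure m p) = ⊤
  · rw [htop]; exact le_top
  obtain ⟨hac, hi, he⟩ := relEnt_eq_of_ne_top htop
  obtain ⟨hac0, hi0, -⟩ := relEnt_eq_of_ne_top hμ
  rw [he, EReal.coe_le_coe_iff]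
  have hrm := (Measure.measurable_rnDeriv μ m).ennreal_toReal
  have hpos : ∀ᵐ z ∂P, 0 < (μ.rnDeriv m z.1).toReal :=
    ae_of_ae_map measurable_fst.aemeasurable (by rw [hfst]; exact toReal_rnDeriv_pos hac0)
  have hlogw : (fun z : α × α => Real.log ((μ.rnDeriv m z.1).toReal *
      tilt (densityKernel m p) φ z)) =ᵐ[P] fun z => Real.log (μ.rnDeriv m z.1).toReal +
        (φ z.2 - logLaplace (densityKernel m p) φ z.1) := by
    filter_upwards [hpos] with z hz
    rw [Real.log_mul hz.ne' (tilt_pos φ z).ne', tilt, Real.log_exp]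
  have j0 : Integrable (fun z : α × α => Real.log (μ.rnDeriv m z.1).toReal) P :=
    Integrable.comp_measurable (f := Prod.fst) (by rwa [hfst]) measurable_fst
  have j1 : Integrable (fun z : α × α => φ z.2) P :=
    Integrable.comp_measurable (f := Prod.snd) (by rw [hsnd]; exact φ.integrable ν) measurable_snd
  have j2 : Integrable (fun z : α × α => logLaplace (densityKernel m p) φ z.1) P :=
    Integrable.comp_measurable (f := Prod.fst) (by
      rw [hfst]; exact integrable_logLaplace (κ := densityKernel m p) φ) measurable_fst
  have j12 : Integrable (fun z : α × α => φ z.2 - logLaplace (densityKernel m p) φ z.1) P :=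
    j1.sub j2
  refine Eq.trans_le ?_ (integral_log_le_integral_log_rnDeriv hac hi
    (w := fun z => (μ.rnDeriv m z.1).toReal * tilt (densityKernel m p) φ z)
    ((hrm.comp measurable_fst).mul (measurable_tilt φ)) ?_ ?_ ((j0.add j12).congr hlogw.symm))
  · rw [integral_congr_ae hlogw, integral_add j0 j12, integral_sub j1 j2, dualFun]
    rw [integral_comp_of_map_eq measurable_fst hfst hi0.1,
      integral_comp_of_map_eq measurable_snd hsnd φ.continuous.measurable.aestronglyMeasurable,
      integral_comp_of_map_eq measurable_fst hfst (measurable_logLaplace φ).aestronglyMeasurable]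
  · filter_upwards [hpos] with z hz
    exact mul_pos hz (tilt_pos φ z)
  · have h1 : ∫⁻ z, ENNReal.ofReal (tilt (densityKernel m p) φ z) ∂(μ ⊗ₘ densityKernel m p) = 1 := by
      have i1 := integrable_compProd_mul_tilt (κ := densityKernel m p) (μ := μ)
        (integrable_const (1 : ℝ)) φ
      have e1 := integral_fst_mul_tilt (κ := densityKernel m p)
        (integrable_const (μ := μ) (1 : ℝ)) φ
      simp only [one_mul] at i1 e1
      rw [← ofReal_integral_eq_lintegral_ofReal i1 (ae_of_all _ fun z => (tilt_pos φ z).le), e1]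
      simp
    have hr : Measurable fun z : α × α => μ.rnDeriv m z.1 :=
      (Measure.measurable_rnDeriv μ m).comp measurable_fst
    rw [compProd_densityKernel hp hac0, lintegral_withDensity_eq_lintegral_mul _ hr
      (measurable_tilt φ).ennreal_ofReal] at h1
    refine h1.le.trans' (lintegral_mono fun z => ?_)
    simp only [Pi.mul_apply]
    rw [ENNReal.ofReal_mul ENNReal.toReal_nonneg]
    exact mul_le_mul_left ENNReal.ofReal_toReal_le _

lemma exists_coupling_relEnt_le [HasOuterApproxClosed α] (hp : Measurable (Function.uncurry p))
    (hμ : relEnt μ m ≠ ⊤) (hB : BddAbove (range (dualFun (densityKernel m p) μ ν))) :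
    ∃ P : Measure (α × α), IsProbabilityMeasure P ∧ P.map Prod.fst = μ ∧ P.map Prod.snd = ν ∧
      relEnt P (refMeasure m p) ≤ ((∫ x, Real.log (μ.rnDeriv m x).toReal ∂μ +
        ⨆ φ, dualFun (densityKernel m p) μ ν φ : ℝ) : EReal) := by
  obtain ⟨hac0, hi0, -⟩ := relEnt_eq_of_ne_top hμ
  obtain ⟨f, hfm, hf0, hfst, hsnd, hint, hle⟩ := exists_density_entropy_le hB
  set Q := μ ⊗ₘ densityKernel m p with hQ
  set P := Q.withDensity fun z => ENNReal.ofReal (f z) with hP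
  have hfm' : Measurable fun z => ENNReal.ofReal (f z) := hfm.ennreal_ofReal
  have hr : Measurable fun z : α × α => μ.rnDeriv m z.1 :=
    (Measure.measurable_rnDeriv μ m).comp measurable_fst
  have hprob : IsProbabilityMeasure P := ⟨by
    have := measure_univ (μ := μ)
    rwa [← hfst, Measure.map_apply measurable_fst MeasurableSet.univ, preimage_univ] at this⟩
  have hPr : P = (refMeasure m p).withDensity
      fun z => μ.rnDeriv m z.1 * ENNReal.ofReal (f z) := by
    rw [hP, hQ, compProd_densityKernel hp hac0, ← withDensity_mul _ hr hfm']
    rfl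
  have hac : P ≪ refMeasure m p := by
    rw [hPr]; exact withDensity_absolutelyContinuous _ _
  have hrn : P.rnDeriv (refMeasure m p) =ᵐ[P]
      fun z => μ.rnDeriv m z.1 * ENNReal.ofReal (f z) := by
    refine hac.ae_le ?_
    rw [hPr]
    exact Measure.rnDeriv_withDensity _ (hr.mul hfm')
  have hpos : ∀ᵐ z ∂P, 0 < (μ.rnDeriv m z.1).toReal :=
    ae_of_ae_map measurable_fst.aemeasurable (by rw [hfst]; exact toReal_rnDeriv_pos hac0)
  have hfpos : ∀ᵐ z ∂P, 0 < f z := by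
    rw [hP, ae_withDensity_iff hfm']
    exact ae_of_all _ fun z hz => by simpa using hz
  have hlog : (fun z => Real.log (P.rnDeriv (refMeasure m p) z).toReal) =ᵐ[P]
      fun z => Real.log (μ.rnDeriv m z.1).toReal + Real.log (f z) := by
    filter_upwards [hrn, hpos, hfpos] with z h1 h2 h3
    rw [h1, ENNReal.toReal_mul, ENNReal.toReal_ofReal h3.le, Real.log_mul h2.ne' h3.ne']
  have j0 : Integrable (fun z : α × α => Real.log (μ.rnDeriv m z.1).toReal) P :=
    Integrable.comp_measurable (f := Prod.fst) (by rwa [hfst]) measurable_fst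
  have j1 : Integrable (fun z => Real.log (f z)) P := by
    rw [hP, integrable_withDensity_iff_integrable_smul' hfm'
      (ae_of_all _ fun _ => ENNReal.ofReal_lt_top)]
    simpa [ENNReal.toReal_ofReal (hf0 _)] using hint
  have e1 : ∫ z, Real.log (f z) ∂P = ∫ z, f z * Real.log (f z) ∂Q := by
    rw [hP, integral_withDensity_eq_integral_toReal_smul hfm'
      (ae_of_all _ fun _ => ENNReal.ofReal_lt_top)]
    simp [ENNReal.toReal_ofReal (hf0 _)]
  have e0 : ∫ z, Real.log (μ.rnDeriv m z.1).toReal ∂P =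
      ∫ x, Real.log (μ.rnDeriv m x).toReal ∂μ :=
    integral_comp_of_map_eq measurable_fst hfst hi0.1
  refine ⟨P, hprob, hfst, hsnd, ?_⟩
  rw [relEnt_of_ac hac ((j0.add j1).congr hlog.symm), EReal.coe_le_coe_iff,
    integral_congr_ae hlog, integral_add j0 j1, e0, e1]
  linarith

end Reference

lemma coe_mul_eq_coe_mul_add_iSup {ι : Type*} [Nonempty ι] {J : ι → ℝ} {A : EReal} {h eps : ℝ}
    (heps : 0 < eps) (hlow : ∀ i, ((h + J i : ℝ) : EReal) ≤ A)
    (hup : BddAbove (range J) → A ≤ ((h + ⨆ i, J i : ℝ) : EReal)) :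
    (eps : EReal) * A = (eps : EReal) * (h : EReal) + ⨆ i, ((eps * J i : ℝ) : EReal) := by
  obtain ⟨i₀⟩ := ‹Nonempty ι›
  have hA : A ≠ ⊥ := ne_bot_of_le_ne_bot (EReal.coe_ne_bot _) (hlow i₀)
  by_cases hB : BddAbove (range J)
  · have hA' : A ≠ ⊤ := ne_top_of_le_ne_top (EReal.coe_ne_top _) (hup hB)
    have : Nonempty ι := ⟨i₀⟩
    lift A to ℝ using ⟨hA', hA⟩
    simp only [EReal.coe_le_coe_iff] at hlow hup
    have hAe : A = h + ⨆ i, J i := le_antisymm (hup hB) <| by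
      have : ⨆ i, J i ≤ A - h := ciSup_le fun i => by linarith [hlow i]
      linarith
    have hsup : ⨆ i, ((eps * J i : ℝ) : EReal) = ((eps * ⨆ i, J i : ℝ) : EReal) := by
      refine le_antisymm (iSup_le fun i => ?_) (EReal.le_of_forall_lt_iff_le.1 fun z hz => ?_)
      · exact EReal.coe_le_coe_iff.2 (mul_le_mul_of_nonneg_left (le_ciSup hB i) heps.le)
      · rw [EReal.coe_le_coe_iff, ← le_div_iff₀' heps]
        refine ciSup_le fun i => (le_div_iff₀' heps).2 ?_
        exact EReal.coe_le_coe_iff.1 ((le_iSup (fun i => ((eps * J i : ℝ) : EReal)) i).trans hz.le)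
    rw [hsup, hAe]
    norm_cast
    ring
  · have hsup : ⨆ i, ((eps * J i : ℝ) : EReal) = ⊤ := by
      rw [EReal.eq_top_iff_forall_lt]
      intro y
      by_contra hy
      refine hB ⟨y / eps, ?_⟩
      rintro _ ⟨i, rfl⟩
      rw [le_div_iff₀' heps]
      exact EReal.coe_le_coe_iff.1
        ((le_iSup (fun i => ((eps * J i : ℝ) : EReal)) i).trans (not_lt.1 hy))
    have hAtop : A = ⊤ := by
      by_contra hA'
      lift A to ℝ using ⟨hA', hA⟩
      refine hB ⟨A - h, ?_⟩
      rintro _ ⟨i, rfl⟩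
      have := EReal.coe_le_coe_iff.1 (hlow i)
      linarith
    rw [hsup, hAtop, EReal.coe_mul_top_of_pos heps, ← EReal.coe_mul, EReal.coe_add_top]

instance {n : ℕ} {V : EuclideanSpace ℝ (Fin n) → ℝ} : SigmaFinite (mV n V) :=
  SigmaFinite.withDensity_ofReal _

lemma Qeps_eq_mul_logLaplace {n : ℕ} {m : Measure (EuclideanSpace ℝ (Fin n))} [SigmaFinite m]
    {p : ℝ → EuclideanSpace ℝ (Fin n) → EuclideanSpace ℝ (Fin n) → ℝ}
    (hp : ∀ t, Measurable (Function.uncurry (p t))) (hp0 : ∀ t x y, 0 ≤ p t x y) {eps u : ℝ}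
    (heps : eps ≠ 0) (hu : u ≠ 0) (φ : EuclideanSpace ℝ (Fin n) →ᵇ ℝ)
    (x : EuclideanSpace ℝ (Fin n)) :
    Qeps n m p eps u (fun y => eps * φ y) x =
      eps * logLaplace (densityKernel m (p (eps * u))) φ x := by
  rw [Qeps, Tsg, if_neg (mul_ne_zero heps hu), logLaplace,
    integral_densityKernel (hp _) (hp0 _)]
  simp only [mul_div_cancel_left₀ _ heps]

end EntropicDuality

/-- **Rescaled dual formulation of the entropic cost** (identity `duep`):
`ε·A^{R^{εu}}(μ0,μ1) = ε·H(μ0|m) + sup{∫ψ dμ1 − ∫ Q^ε_u ψ dμ0 : ψ ∈ C_b(ℝⁿ)}`. -/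
theorem rescaled_entropic_dual (n : ℕ) (hn : 0 < n)
    (V : EuclideanSpace ℝ (Fin n) → ℝ) (hV : ContDiff ℝ 2 V) (hExi : Exi n V)
    (p : ℝ → EuclideanSpace ℝ (Fin n) → EuclideanSpace ℝ (Fin n) → ℝ)
    (hKol : IsKolmogorov n V (mV n V) p)
    (eps u : ℝ) (heps : 0 < eps) (hu : 0 < u)
    (μ0 μ1 : Measure (EuclideanSpace ℝ (Fin n)))
    (hμ0 : IsProbabilityMeasure μ0) (hμ1 : IsProbabilityMeasure μ1)
    (hReg2 : Reg2 n (mV n V) (p (eps * u)) μ0 μ1) :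
    ((eps : ℝ) : EReal) * entCost (R01 n (mV n V) (p (eps * u))) μ0 μ1 =
      ((eps : ℝ) : EReal) * relEnt μ0 (mV n V) +
        sSup { s : EReal | ∃ ψ : EuclideanSpace ℝ (Fin n) → ℝ, Continuous ψ ∧
          (∃ C : ℝ, ∀ x, |ψ x| ≤ C) ∧
          s = (((∫ y, ψ y ∂μ1) - ∫ x, Qeps n (mV n V) p eps u ψ x ∂μ0 : ℝ) : EReal) } := by
  have := EntropicDuality.isMarkovKernel_densityKernel (hKol.meas (eps * u)) (hKol.nonneg (eps * u))
    (hKol.mass (eps * u) (mul_pos heps hu))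
  have hH := hReg2.2.1
  have hlow (φ : BoundedContinuousFunction (EuclideanSpace ℝ (Fin n)) ℝ) :
      ((∫ x, Real.log (μ0.rnDeriv (mV n V) x).toReal ∂μ0 + EntropicDuality.dualFun
        (EntropicDuality.densityKernel (mV n V) (p (eps * u))) μ0 μ1 φ : ℝ) : EReal) ≤
        entCost (R01 n (mV n V) (p (eps * u))) μ0 μ1 := by
    refine le_sInf ?_
    rintro _ ⟨P, hP, hfst, hsnd, rfl⟩
    exact EntropicDuality.add_dualFun_le_relEnt (hKol.meas _) hH hfst hsnd φ
  have hup (hB : BddAbove (range (EntropicDuality.dualFun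
      (EntropicDuality.densityKernel (mV n V) (p (eps * u))) μ0 μ1))) :
      entCost (R01 n (mV n V) (p (eps * u))) μ0 μ1 ≤
        ((∫ x, Real.log (μ0.rnDeriv (mV n V) x).toReal ∂μ0 + ⨆ φ, EntropicDuality.dualFun
          (EntropicDuality.densityKernel (mV n V) (p (eps * u))) μ0 μ1 φ : ℝ) : EReal) := by
    obtain ⟨P, hP, hfst, hsnd, hle⟩ :=
      EntropicDuality.exists_coupling_relEnt_le (hKol.meas (eps * u)) hH hB
    exact sInf_le_of_le ⟨P, hP, hfst, hsnd, rfl⟩ hle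
  rw [(EntropicDuality.relEnt_eq_of_ne_top hH).2.2,
    EntropicDuality.coe_mul_eq_coe_mul_add_iSup heps hlow hup, ← sSup_range]
  have hJ (φ : BoundedContinuousFunction (EuclideanSpace ℝ (Fin n)) ℝ) :
      ∫ y, eps * φ y ∂μ1 - ∫ x, Qeps n (mV n V) p eps u (fun y => eps * φ y) x ∂μ0 =
        eps * EntropicDuality.dualFun
          (EntropicDuality.densityKernel (mV n V) (p (eps * u))) μ0 μ1 φ := by
    simp only [EntropicDuality.Qeps_eq_mul_logLaplace hKol.meas hKol.nonneg heps.ne' hu.ne',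
      integral_const_mul, EntropicDuality.dualFun, mul_sub]
  congr 2
  ext s
  constructor
  · rintro ⟨φ, rfl⟩
    refine ⟨fun y => eps * φ y, continuous_const.mul φ.continuous, ⟨eps * ‖φ‖, fun x => ?_⟩, ?_⟩
    · rw [abs_mul, abs_of_pos heps]
      exact mul_le_mul_of_nonneg_left (φ.norm_coe_le_norm x) heps.le
    · rw [hJ]
  · rintro ⟨ψ, hψ, ⟨C, hC⟩, rfl⟩
    have hb (x : EuclideanSpace ℝ (Fin n)) : ‖ψ x / eps‖ ≤ C / eps := by
      rw [norm_div, Real.norm_of_nonneg heps.le]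
      exact div_le_div_of_nonneg_right (hC x) heps.le
    have e := hJ (BoundedContinuousFunction.ofNormedAddCommGroup (fun x => ψ x / eps)
      (hψ.div_const eps) _ hb)
    simp only [BoundedContinuousFunction.coe_ofNormedAddCommGroup, mul_div_cancel₀ _ heps.ne'] at e
    exact ⟨_, congrArg _ e.symm⟩
end
end
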